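/- arXiv:1607.05310 — 2 statements merged into one kernel-verified Lean document; each statement's English description precedes it below -/
import Mathlib

section
/- Let G be a group admitting a finite chain of subgroups {1} = G_{d+1} ≤ G_d ≤ ⋯ ≤ G_1 ≤ G_0 = G, each G_i normal in G, such that every successive quotient G_i/G_{i+1} has locally subexponential growth (every finitely generated subgroup of G_i/G_{i+1} has subexponential growth). Suppose G acts on the real line by order-preserving homeomorphisms and there exists T ∈ G with T(x) ≠ x for all x ∈ ℝ. Then there exists a nonzero Radon measure μ on ℝ that is quasi-invariant under G: for every g ∈ G there is a real λ_g > 0 such that g_*μ = λ_g·μ, where g_*μ(B) = μ(g⁻¹(B)). -/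
open MeasureTheory Pointwise

/-- A Borel measure on ℝ is a Radon measure if it gives finite mass to compact sets. -/
def IsRadon (μ : Measure ℝ) : Prop := ∀ K : Set ℝ, IsCompact K → μ K < ⊤

/-- A group `H` has subexponential growth if for every finite symmetric generating set `S`
containing the identity and every `c > 1`, one has `card (S ^ n) ≤ c ^ n` for all
sufficiently large `n`. -/
def HasSubexponentialGrowth (H : Type*) [Group H] : Prop :=
  ∀ S : Set H, S.Finite → (1 : H) ∈ S → (∀ s ∈ S, s⁻¹ ∈ S) → Subgroup.closure S = ⊤ →
    ∀ c : ℝ, 1 < c → ∀ᶠ n in Filter.atTop, (Nat.card (S ^ n : Set H) : ℝ) ≤ c ^ n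

/-- A group has locally subexponential growth if every finitely generated subgroup
has subexponential growth. -/
def LocallySubexponentialGrowth (H : Type*) [Group H] : Prop :=
  ∀ K : Subgroup H, K.FG → HasSubexponentialGrowth K

/-- Every finitely generated subgroup of `H` has subexponential growth along the orbit of `x`. -/
def SubexpOrbitGrowth {G : Type*} [Group G] (ρ : G →* (ℝ ≃o ℝ)) (H : Subgroup G) (x : ℝ) : Prop :=
  ∀ S : Set G, S.Finite → (1 : G) ∈ S → (∀ s ∈ S, s⁻¹ ∈ S) → S ⊆ H →
    ∀ c : ℝ, 1 < c →
      ∀ᶠ n : ℕ in Filter.atTop, (((fun g => ρ g x) '' (S ^ n)).ncard : ℝ) ≤ c ^ n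

section Action

variable {G : Type*} [Group G] (ρ : G →* (ℝ ≃o ℝ))

lemma act_mul (g h : G) (x : ℝ) : ρ (g * h) x = ρ g (ρ h x) := by
  rw [map_mul]; rfl

lemma act_one (x : ℝ) : ρ 1 x = x := by
  rw [map_one]; rfl

lemma act_inv_act (g : G) (x : ℝ) : ρ g⁻¹ (ρ g x) = x := by
  rw [← act_mul, inv_mul_cancel, act_one]

lemma act_act_inv (g : G) (x : ℝ) : ρ g (ρ g⁻¹ x) = x := by
  rw [← act_mul, mul_inv_cancel, act_one]

lemma act_image_image (g h : G) (A : Set ℝ) : ρ g '' (ρ h '' A) = ρ (g * h) '' A := by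
  ext y; simp

lemma act_image_inv_image (g : G) (A : Set ℝ) : ρ g '' (ρ g⁻¹ '' A) = A := by
  rw [act_image_image, mul_inv_cancel, map_one]
  exact Set.image_id A

lemma ncard_act_image (g : G) (A : Set ℝ) : (ρ g '' A).ncard = A.ncard :=
  Set.ncard_image_of_injective A (ρ g).injective

lemma exists_ratio_le {L : ℕ → ℝ} (h0 : 1 ≤ L 0)
    (hL : ∀ c : ℝ, 1 < c → ∀ᶠ n : ℕ in Filter.atTop, L n ≤ c ^ n) {ε : ℝ} (hε : 0 < ε) :
    ∃ n, L (n + 4) ≤ (1 + ε) * L n := by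
  by_contra! hcon
  have key : ∀ k : ℕ, (1 + ε) ^ k ≤ L (4 * k) := by
    intro k
    induction k with
    | zero => simpa using h0
    | succ k ih =>
      have h1 := hcon (4 * k)
      rw [pow_succ, show 4 * (k + 1) = 4 * k + 4 by ring]
      nlinarith
  have hc : 1 < √(√(1 + ε)) := by
    rw [Real.lt_sqrt (by norm_num), Real.lt_sqrt (by norm_num)]
    linarith
  obtain ⟨n, hn⟩ := (hL _ hc).exists_forall_of_atTop
  have h1 := hn (4 * (n + 1)) (by omega)
  have h2 : √(√(1 + ε)) ^ (4 * (n + 1)) = (1 + ε) ^ (n + 1) := by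
    rw [pow_mul, show (4 : ℕ) = 2 * 2 from rfl, pow_mul, Real.sq_sqrt (by positivity),
      Real.sq_sqrt (by positivity)]
  have h3 := hcon (4 * n)
  have h4 := key n
  rw [h2, show 4 * (n + 1) = 4 * n + 4 by ring, pow_succ] at h1
  nlinarith

/-- Subexponential orbit growth yields finite sets that are almost invariant as seen from
translates of a given window. -/
lemma exists_almost_invariant {H : Subgroup G} {x : ℝ} (hH : SubexpOrbitGrowth ρ H x)
    {I : Set ℝ} (hx : x ∈ I) (E : Finset G) (hE : ∀ g ∈ E, g ∈ H) {ε : ℝ} (hε : 0 < ε) :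
    ∃ A : Set ℝ, A.Finite ∧ (A ∩ I).Nonempty ∧ ∀ g ∈ E, ∀ h ∈ E,
      ((symmDiff (ρ g '' A) A ∩ ρ h '' I).ncard : ℝ) ≤ ε * (A ∩ I).ncard := by
  set S : Set G := ((E : Set G) ∪ (E : Set G)⁻¹) ∪ {1} with hS
  have hSfin : S.Finite := (E.finite_toSet.union E.finite_toSet.inv).union (Set.finite_singleton 1)
  have h1S : (1 : G) ∈ S := by simp [hS]
  have hSinv : ∀ s ∈ S, s⁻¹ ∈ S := by
    intro s hs
    simp only [hS, Set.mem_union, Set.mem_inv, inv_inv, Set.mem_singleton_iff, inv_eq_one] at hs ⊢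
    tauto
  have hSH : S ⊆ H := by
    rintro s ((hs | hs) | hs)
    · exact hE s hs
    · simpa using hE _ hs
    · rw [hs]; exact H.one_mem
  have hES : ∀ g ∈ E, g ∈ S := fun g hg => Or.inl (Or.inl hg)
  set A : ℕ → Set ℝ := fun n => (fun g => ρ g x) '' (S ^ n) with hA
  have hSpow : ∀ n, (S ^ n).Finite := by
    intro n
    induction n with
    | zero => simp
    | succ n ih => rw [pow_succ]; exact ih.mul hSfin
  have hAfin : ∀ n, (A n).Finite := fun n => (hSpow n).image _
  have hmove : ∀ n, ∀ g ∈ S, ∀ y ∈ A n, ρ g y ∈ A (n + 1) := by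
    rintro n g hg _ ⟨k, hk, rfl⟩
    refine ⟨g * k, ?_, act_mul ρ g k x⟩
    rw [pow_succ']
    exact Set.mul_mem_mul hg hk
  have hmono : ∀ n, A n ⊆ A (n + 1) := by
    intro n y hy
    have := hmove n 1 h1S y hy
    rwa [act_one] at this
  have hxA : ∀ n, x ∈ A n := by
    intro n
    induction n with
    | zero => exact ⟨1, by simp, act_one ρ x⟩
    | succ n ih => exact hmono n ih
  have hpos : ∀ n, (1 : ℝ) ≤ (A n ∩ I).ncard := by
    intro n
    have : 0 < (A n ∩ I).ncard :=
      (Set.ncard_pos ((hAfin n).inter_of_left I)).2 ⟨x, hxA n, hx⟩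
    exact_mod_cast this
  obtain ⟨n, hn⟩ := exists_ratio_le (L := fun n => ((A n ∩ I).ncard : ℝ)) (hpos 0)
    (fun c hc => by
      filter_upwards [hH S hSfin h1S hSinv hSH c hc] with n hn
      refine le_trans ?_ hn
      exact_mod_cast Set.ncard_le_ncard Set.inter_subset_left (hAfin n)) hε
  have hsub : A n ∩ I ⊆ A (n + 4) ∩ I :=
    Set.inter_subset_inter_left _ ((hmono _).trans ((hmono _).trans ((hmono _).trans (hmono _))))
  refine ⟨A (n + 2), hAfin _, ⟨x, hxA _, hx⟩, fun g hg h hh => ?_⟩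
  have hincl : ρ h⁻¹ '' (symmDiff (ρ g '' A (n + 2)) (A (n + 2)) ∩ ρ h '' I)
      ⊆ (A (n + 4) ∩ I) \ (A n ∩ I) := by
    rintro _ ⟨y, ⟨hy, z, hz, rfl⟩, rfl⟩
    rw [act_inv_act]
    have hup : ρ h z ∈ A (n + 3) := by
      rcases hy with ⟨⟨w, hw, hwz⟩, -⟩ | ⟨hw, -⟩
      · rw [← hwz]; exact hmove _ g (hES g hg) _ hw
      · exact hmono _ hw
    refine ⟨⟨?_, hz⟩, fun hzn => ?_⟩
    · have := hmove _ h⁻¹ (hSinv h (hES h hh)) _ hup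
      rwa [act_inv_act] at this
    · have h1 : ρ h z ∈ A (n + 1) := hmove _ h (hES h hh) _ hzn.1
      rcases hy with ⟨-, hw⟩ | ⟨-, hw⟩
      · exact hw (hmono _ h1)
      · refine hw ⟨ρ g⁻¹ (ρ h z), hmove _ _ (hSinv g (hES g hg)) _ h1, act_act_inv ρ g _⟩
  have hcard := Set.ncard_le_ncard hincl (((hAfin _).inter_of_left I).sdiff)
  rw [ncard_act_image] at hcard
  have hdiff := Set.ncard_sdiff_add_ncard_of_subset hsub ((hAfin _).inter_of_left I)
  have hle : ((A n ∩ I).ncard : ℝ) ≤ (A (n + 2) ∩ I).ncard := by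
    exact_mod_cast Set.ncard_le_ncard
      (Set.inter_subset_inter_left _ ((hmono _).trans (hmono _))) ((hAfin _).inter_of_left I)
  have hcard' : ((symmDiff (ρ g '' A (n + 2)) (A (n + 2)) ∩ ρ h '' I).ncard : ℝ) ≤
      (((A (n + 4) ∩ I) \ (A n ∩ I)).ncard : ℝ) := by exact_mod_cast hcard
  have hdiff' : (((A (n + 4) ∩ I) \ (A n ∩ I)).ncard : ℝ) + (A n ∩ I).ncard
      = (A (n + 4) ∩ I).ncard := by exact_mod_cast hdiff
  nlinarith

lemma abs_ncard_inter_sub_le {P Q : Set ℝ} (hP : P.Finite) (hQ : Q.Finite) (B : Set ℝ) :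
    |((P ∩ B).ncard : ℝ) - (Q ∩ B).ncard| ≤ ((symmDiff P Q ∩ B).ncard : ℝ) := by
  have aux : ∀ {P Q : Set ℝ}, P.Finite → Q.Finite →
      ((P ∩ B).ncard : ℝ) ≤ (Q ∩ B).ncard + ((symmDiff P Q ∩ B).ncard : ℝ) := by
    intro P Q hP hQ
    have hsub : P ∩ B ⊆ (Q ∩ B) ∪ (symmDiff P Q ∩ B) := by
      rintro y ⟨hy, hyB⟩
      by_cases hyQ : y ∈ Q
      · exact Or.inl ⟨hyQ, hyB⟩
      · exact Or.inr ⟨Or.inl ⟨hy, hyQ⟩, hyB⟩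
    have hfin : (Q ∩ B ∪ symmDiff P Q ∩ B).Finite :=
      (hQ.inter_of_left B).union ((hP.symmDiff hQ).inter_of_left B)
    exact_mod_cast (Set.ncard_le_ncard hsub hfin).trans (Set.ncard_union_le _ _)
  have h1 := aux hP hQ
  have h2 := aux hQ hP
  rw [symmDiff_comm Q P] at h2
  rw [abs_le]
  constructor <;> linarith

lemma ncard_inter_le_sum {A B I : Set ℝ} (hA : A.Finite) {s : Finset G}
    (hB : B ⊆ ⋃ h ∈ s, ρ h '' I) :
    ((A ∩ B).ncard : ℝ) ≤ ∑ h ∈ s, ((A ∩ ρ h '' I).ncard : ℝ) := by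
  have hsub : A ∩ B ⊆ ⋃ h ∈ s, (A ∩ ρ h '' I) := by
    rintro y ⟨hy, hyB⟩
    obtain ⟨h, hs, hyh⟩ := Set.mem_iUnion₂.1 (hB hyB)
    exact Set.mem_iUnion₂.2 ⟨h, hs, hy, hyh⟩
  have hfin : (⋃ h ∈ s, (A ∩ ρ h '' I)).Finite :=
    s.finite_toSet.biUnion fun h _ => hA.inter_of_left _
  exact_mod_cast (Set.ncard_le_ncard hsub hfin).trans
    (Finset.set_ncard_biUnion_le s fun h => A ∩ ρ h '' I)

/-- The interval `[a, b)` is covered by finitely many `H`-translates of `I`. -/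
def Covered (H : Subgroup G) (I : Set ℝ) (a b : ℝ) : Prop :=
  ∃ s : Finset G, (∀ h ∈ s, h ∈ H) ∧ Set.Ico a b ⊆ ⋃ h ∈ s, ρ h '' I

variable {ρ}

lemma Covered.mono {H : Subgroup G} {I : Set ℝ} {a b a' b' : ℝ} (h : Covered ρ H I a b)
    (ha : a ≤ a') (hb : b' ≤ b) : Covered ρ H I a' b' := by
  obtain ⟨s, hs, hsub⟩ := h
  exact ⟨s, hs, (Set.Ico_subset_Ico ha hb).trans hsub⟩

lemma Covered.trans {H : Subgroup G} {I : Set ℝ} {a b c : ℝ} (h₁ : Covered ρ H I a b)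
    (h₂ : Covered ρ H I b c) : Covered ρ H I a c := by
  classical
  obtain ⟨s, hs, hsub⟩ := h₁
  obtain ⟨t, ht, htub⟩ := h₂
  refine ⟨s ∪ t, fun h hh => (Finset.mem_union.1 hh).elim (hs h) (ht h), ?_⟩
  refine (Set.Ico_subset_Ico_union_Ico (b := b)).trans ?_
  rw [Finset.set_biUnion_union]
  exact Set.union_subset_union hsub htub

lemma Covered.act {H : Subgroup G} {I : Set ℝ} {a b : ℝ} (h : Covered ρ H I a b) {g : G}
    (hg : g ∈ H) : Covered ρ H I (ρ g a) (ρ g b) := by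
  classical
  obtain ⟨s, hs, hsub⟩ := h
  refine ⟨s.image (g * ·), ?_, ?_⟩
  · intro k hk
    obtain ⟨h, hh, rfl⟩ := Finset.mem_image.1 hk
    exact H.mul_mem hg (hs h hh)
  · rw [← (ρ g).image_Ico]
    rintro _ ⟨y, hy, rfl⟩
    obtain ⟨h, hh, z, hz, rfl⟩ := Set.mem_iUnion₂.1 (hsub hy)
    exact Set.mem_iUnion₂.2 ⟨g * h, Finset.mem_image_of_mem _ hh, z, hz, act_mul ρ g h z⟩

lemma Covered.of_le {H : Subgroup G} {I : Set ℝ} {a b : ℝ} (h : b ≤ a) :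
    Covered ρ H I a b :=
  ⟨∅, by simp, by simp [Set.Ico_eq_empty_of_le h]⟩

lemma Covered.of_subset {H : Subgroup G} {I : Set ℝ} {a b : ℝ} (h : Set.Ico a b ⊆ I) :
    Covered ρ H I a b :=
  ⟨{1}, by simp, by simpa using h⟩

variable (ρ)

/-- The points joined to `x` by finitely many `H`-translates of `I`. -/
def coveredSet (H : Subgroup G) (I : Set ℝ) (x : ℝ) : Set ℝ :=
  {y | Covered ρ H I x y ∧ Covered ρ H I y x}

variable {ρ}

lemma self_mem_coveredSet {H : Subgroup G} {I : Set ℝ} {x : ℝ} : x ∈ coveredSet ρ H I x :=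
  ⟨.of_le le_rfl, .of_le le_rfl⟩

lemma mem_coveredSet_of_le {H : Subgroup G} {I : Set ℝ} {x a b y : ℝ}
    (ha : a ∈ coveredSet ρ H I x) (hb : b ∈ coveredSet ρ H I x) (hay : a ≤ y) (hyb : y ≤ b) :
    y ∈ coveredSet ρ H I x :=
  ⟨hb.1.mono le_rfl hyb, ha.2.mono hay le_rfl⟩

lemma act_mem_coveredSet {H : Subgroup G} {I : Set ℝ} {x y : ℝ}
    (hcov : ∀ g ∈ H, Covered ρ H I x (ρ g x)) {g : G} (hg : g ∈ H)
    (hy : y ∈ coveredSet ρ H I x) : ρ g y ∈ coveredSet ρ H I x := by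
  refine ⟨(hcov g hg).trans (hy.1.act hg), (hy.2.act hg).trans ?_⟩
  have := (hcov g⁻¹ (H.inv_mem hg)).act hg
  rwa [act_act_inv] at this

variable (ρ)

lemma ncard_Iio_sub_le {A : Set ℝ} (hA : A.Finite) (a b : ℝ) :
    ((A ∩ Set.Iio b).ncard : ℝ) - (A ∩ Set.Iio a).ncard ≤ (A ∩ Set.Ico a b).ncard := by
  have hsub : A ∩ Set.Iio b ⊆ (A ∩ Set.Iio a) ∪ (A ∩ Set.Ico a b) := by
    rintro y ⟨hy, hyb⟩
    rcases lt_or_ge y a with h | h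
    · exact Or.inl ⟨hy, h⟩
    · exact Or.inr ⟨hy, h, hyb⟩
  have := (Set.ncard_le_ncard hsub ((hA.inter_of_left _).union (hA.inter_of_left _))).trans
    (Set.ncard_union_le _ _)
  rw [sub_le_iff_le_add']
  exact_mod_cast this

lemma ncard_Iio_sub_eq {A : Set ℝ} (hA : A.Finite) {a b : ℝ} (hab : a ≤ b) :
    ((A ∩ Set.Iio b).ncard : ℝ) - (A ∩ Set.Iio a).ncard = (A ∩ Set.Ico a b).ncard := by
  have heq : A ∩ Set.Iio b = (A ∩ Set.Iio a) ∪ (A ∩ Set.Ico a b) := by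
    rw [← Set.inter_union_distrib_left, Set.Iio_union_Ico_eq_Iio hab]
  have hdis : Disjoint (A ∩ Set.Iio a) (A ∩ Set.Ico a b) := by
    rw [Set.disjoint_left]
    rintro y ⟨-, hy⟩ ⟨-, hy', -⟩
    exact absurd hy (not_lt.2 hy')
  rw [heq, Set.ncard_union_eq hdis (hA.inter_of_left _) (hA.inter_of_left _)]
  push_cast
  ring

/-- A group of subexponential orbit growth is semiconjugate to a group of translations on the
set covered by translates of `[x, M)`. -/
lemma exists_semiconj_translation {H : Subgroup G} {x M : ℝ} (hxM : x < M)
    (hH : SubexpOrbitGrowth ρ H x)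
    (hcov : ∀ g ∈ H, Covered ρ H (Set.Ico x M) x (ρ g x)) :
    ∃ φ τ : _ → ℝ, MonotoneOn φ (coveredSet ρ H (Set.Ico x M) x) ∧
      (∀ g ∈ H, ∀ y ∈ coveredSet ρ H (Set.Ico x M) x, φ (ρ g y) = φ y + τ g) ∧
      φ M = φ x + 1 := by
  classical
  set I := Set.Ico x M with hI
  set J := coveredSet ρ H I x with hJ
  have hxI : x ∈ I := ⟨le_rfl, hxM⟩
  have hex : ∀ i : Finset H × ℕ, ∃ A : Set ℝ, A.Finite ∧ (A ∩ I).Nonempty ∧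
      ∀ g ∈ i.1, ∀ h ∈ i.1, ((symmDiff (ρ g '' A) A ∩ ρ (h : G) '' I).ncard : ℝ) ≤
        1 / ((i.2 : ℝ) + 1) * (A ∩ I).ncard := by
    intro i
    obtain ⟨A, h1, h2, h3⟩ := exists_almost_invariant ρ hH hxI (i.1.image (fun g : H => (g : G)))
      (by intro g hg; obtain ⟨k, -, rfl⟩ := Finset.mem_image.1 hg; exact k.2)
      (ε := 1 / ((i.2 : ℝ) + 1)) (by positivity)
    exact ⟨A, h1, h2, fun g hg h hh => h3 _ (Finset.mem_image_of_mem _ hg) _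
      (Finset.mem_image_of_mem _ hh)⟩
  choose A hAfin hAne hA using hex
  set L : Finset H × ℕ → ℝ := fun i => ((A i ∩ I).ncard : ℝ) with hL
  have hLpos : ∀ i, 0 < L i := fun i => by
    exact Nat.cast_pos.2 ((Set.ncard_pos ((hAfin i).inter_of_left I)).2 (hAne i))
  set ψ : Finset H × ℕ → ℝ → ℝ := fun i y =>
    (((A i ∩ Set.Iio y).ncard : ℝ) - (A i ∩ Set.Iio x).ncard) / L i with hψ
  have hψsub : ∀ i a b, ψ i b - ψ i a =
      (((A i ∩ Set.Iio b).ncard : ℝ) - (A i ∩ Set.Iio a).ncard) / L i := by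
    intro i a b
    simp only [hψ]
    ring
  have hψmono : ∀ i, Monotone (ψ i) := by
    intro i a b hab
    have h := hψsub i a b
    rw [ncard_Iio_sub_eq (hAfin i) hab] at h
    have : 0 ≤ ψ i b - ψ i a := by rw [h]; have := hLpos i; positivity
    linarith
  have hbig : ∀ s : Finset G, (∀ h ∈ s, h ∈ H) →
      ∀ᶠ i : Finset H × ℕ in Filter.atTop, ∀ h (hh : h ∈ H), h ∈ s → (⟨h, hh⟩ : H) ∈ i.1 := by
    intro s hs
    have h1 : ∀ᶠ E : Finset H in Filter.atTop, s.subtype (· ∈ H) ≤ E :=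
      Filter.eventually_ge_atTop _
    rw [← Filter.prod_atTop_atTop_eq]
    filter_upwards [Filter.tendsto_fst.eventually h1] with i hi h hh hhs
    exact hi (Finset.mem_subtype.2 hhs)
  have hbdd : ∀ a b, Covered ρ H I a b →
      ∃ C : ℝ, ∀ᶠ i in Filter.atTop, ψ i b - ψ i a ≤ C := by
    rintro a b ⟨s, hs, hsub⟩
    refine ⟨s.card * 2, ?_⟩
    filter_upwards [hbig (insert 1 (s ∪ s.image (·⁻¹))) (by
      intro h hh
      simp only [Finset.mem_insert, Finset.mem_union, Finset.mem_image] at hh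
      rcases hh with rfl | hh | ⟨k, hk, rfl⟩
      · exact H.one_mem
      · exact hs h hh
      · exact H.inv_mem (hs k hk))] with i hi
    rw [hψsub, div_le_iff₀ (hLpos i)]
    refine (ncard_Iio_sub_le (hAfin i) a b).trans ((ncard_inter_le_sum ρ (hAfin i) hsub).trans ?_)
    rw [mul_assoc, ← nsmul_eq_mul]
    refine Finset.sum_le_card_nsmul _ _ _ fun h hh => ?_
    have h1 := abs_ncard_inter_sub_le ((hAfin i).image (ρ h⁻¹)) (hAfin i) I
    have h2 := hA i ⟨h⁻¹, H.inv_mem (hs h hh)⟩ (hi _ _ (by simp [hh])) ⟨1, H.one_mem⟩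
      (hi _ _ (by simp))
    simp only [map_one, RelIso.coe_one, Set.image_id] at h2
    have h3 : (A i ∩ ρ h '' I).ncard = (ρ h⁻¹ '' A i ∩ I).ncard := by
      rw [← ncard_act_image ρ h (ρ h⁻¹ '' A i ∩ I), Set.image_inter (ρ h).injective,
        act_image_inv_image]
    have h4 : 1 / ((i.2 : ℝ) + 1) * L i ≤ L i := by
      have : 1 / ((i.2 : ℝ) + 1) ≤ 1 := by
        rw [div_le_one (by positivity)]
        have : (0 : ℝ) ≤ i.2 := by positivity
        linarith
      nlinarith [hLpos i]
    rw [h3]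
    have h5 := (abs_le.1 h1).2
    simp only [hL] at h4 ⊢
    linarith
  set 𝒰 : Ultrafilter (Finset H × ℕ) := Ultrafilter.of Filter.atTop with h𝒰
  have h𝒰le : (𝒰 : Filter (Finset H × ℕ)) ≤ Filter.atTop := Ultrafilter.of_le _
  have hψx : ∀ i, ψ i x = 0 := fun i => by simp [hψ]
  have hlim : ∀ y, y ∈ J → ∃ l, Filter.Tendsto (fun i => ψ i y) 𝒰 (nhds l) := by
    rintro y ⟨h1, h2⟩
    obtain ⟨C, hC⟩ := hbdd _ _ h1
    obtain ⟨D, hD⟩ := hbdd _ _ h2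
    have hmem : ∀ᶠ i in (𝒰 : Filter _), ψ i y ∈ Set.Icc (-D) C := by
      filter_upwards [h𝒰le hC, h𝒰le hD] with i hi hi'
      rw [hψx] at hi hi'
      constructor <;> linarith
    obtain ⟨l, -, hl⟩ := (isCompact_Icc (a := -D) (b := C)).ultrafilter_le_nhds
      (𝒰.map (fun i => ψ i y)) (Filter.le_principal_iff.2 hmem)
    exact ⟨l, hl⟩
  choose! φ hφ using hlim
  have hxJ : x ∈ J := self_mem_coveredSet
  have hinv : ∀ g ∈ H, ∀ a b, a ≤ b → Covered ρ H I a b →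
      Filter.Tendsto (fun i => (ψ i (ρ g b) - ψ i (ρ g a)) - (ψ i b - ψ i a)) Filter.atTop
        (nhds 0) := by
    rintro g hg a b hab ⟨s, hs, hsub⟩
    have hlim0 : Filter.Tendsto (fun i : Finset H × ℕ => (s.card : ℝ) * (1 / ((i.2 : ℝ) + 1)))
        Filter.atTop (nhds 0) := by
      have h1 : Filter.Tendsto (fun n : ℕ => (s.card : ℝ) * (1 / ((n : ℝ) + 1))) Filter.atTop
          (nhds 0) := by
        simpa using (tendsto_one_div_add_atTop_nhds_zero_nat (𝕜 := ℝ)).const_mul (s.card : ℝ)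
      rw [← Filter.prod_atTop_atTop_eq]
      exact h1.comp Filter.tendsto_snd
    refine squeeze_zero_norm' ?_ hlim0
    filter_upwards [hbig (insert g⁻¹ s) (by
      intro h hh
      rcases Finset.mem_insert.1 hh with rfl | hh
      · exact H.inv_mem hg
      · exact hs h hh)] with i hi
    rw [hψsub, hψsub, ncard_Iio_sub_eq (hAfin i) hab,
      ncard_Iio_sub_eq (hAfin i) ((ρ g).monotone hab), ← (ρ g).image_Ico, ← sub_div, norm_div,
      Real.norm_eq_abs, Real.norm_of_nonneg (hLpos i).le, div_le_iff₀ (hLpos i)]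
    have h3 : (A i ∩ ρ g '' Set.Ico a b).ncard = (ρ g⁻¹ '' A i ∩ Set.Ico a b).ncard := by
      rw [← ncard_act_image ρ g (ρ g⁻¹ '' A i ∩ Set.Ico a b), Set.image_inter (ρ g).injective,
        act_image_inv_image]
    rw [h3]
    refine (abs_ncard_inter_sub_le ((hAfin i).image (ρ g⁻¹)) (hAfin i) _).trans ?_
    refine (ncard_inter_le_sum ρ (((hAfin i).image _).symmDiff (hAfin i)) hsub).trans ?_
    rw [mul_assoc, ← nsmul_eq_mul]
    refine Finset.sum_le_card_nsmul _ _ _ fun h hh => ?_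
    exact hA i ⟨g⁻¹, H.inv_mem hg⟩ (hi _ _ (by simp)) ⟨h, hs h hh⟩ (hi _ _ (by simp [hh]))
  have hact : ∀ g ∈ H, ∀ y ∈ J, ρ g y ∈ J := fun g hg y hy => act_mem_coveredSet hcov hg hy
  refine ⟨φ, fun g => φ (ρ g x) - φ x, ?_, ?_, ?_⟩
  · intro a ha b hb hab
    exact le_of_tendsto_of_tendsto' (hφ a ha) (hφ b hb) fun i => hψmono i hab
  · intro g hg y hy
    have hlim1 := ((hφ _ (hact g hg y hy)).sub (hφ _ (hact g hg x hxJ))).sub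
      ((hφ y hy).sub (hφ x hxJ))
    have hzero : (φ (ρ g y) - φ (ρ g x)) - (φ y - φ x) = 0 := by
      rcases le_total x y with hxy | hyx
      · exact tendsto_nhds_unique hlim1 ((hinv g hg x y hxy hy.1).mono_left h𝒰le)
      · have h1 := ((hinv g hg y x hyx hy.2).mono_left h𝒰le).neg
        rw [neg_zero] at h1
        refine tendsto_nhds_unique hlim1 (h1.congr fun i => ?_)
        ring
    linarith
  · have hMJ : M ∈ J := ⟨.of_subset le_rfl, .of_le hxM.le⟩
    have h1 : ∀ i, ψ i M - ψ i x = 1 := fun i => by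
      rw [hψsub, ncard_Iio_sub_eq (hAfin i) hxM.le]
      exact div_self (hLpos i).ne'
    have h2 := ((hφ M hMJ).sub (hφ x hxJ)).congr h1
    have := tendsto_nhds_unique h2 tendsto_const_nhds
    linarith

variable {ρ}

lemma SubexpOrbitGrowth.mono {H N : Subgroup G} {x : ℝ} (hN : SubexpOrbitGrowth ρ N x)
    (hHN : H ≤ N) : SubexpOrbitGrowth ρ H x :=
  fun S h1 h2 h3 h4 => hN S h1 h2 h3 (h4.trans hHN)

lemma semiconj_zpow {H : Subgroup G} {J : Set ℝ} {φ τ : _ → ℝ}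
    (hJ : ∀ g ∈ H, ∀ y ∈ J, ρ g y ∈ J) (hφ : ∀ g ∈ H, ∀ y ∈ J, φ (ρ g y) = φ y + τ g)
    {g : G} (hg : g ∈ H) {y : ℝ} (hy : y ∈ J) (k : ℤ) : φ (ρ (g ^ k) y) = φ y + k * τ g := by
  induction k with
  | zero => simp
  | succ k ih =>
    rw [add_comm, zpow_add, zpow_one, act_mul, hφ g hg _ (hJ _ (H.zpow_mem hg _) _ hy), ih]
    push_cast
    ring
  | pred k ih =>
    have h := hφ g hg _ (hJ _ (H.zpow_mem hg (-(k : ℤ) - 1)) _ hy)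
    rw [← act_mul, ← zpow_one_add, show 1 + (-(k : ℤ) - 1) = -k by ring, ih] at h
    push_cast at h ⊢
    linarith

lemma covered_act_of_mem_closure {S I : Set _} {x : ℝ}
    (h : ∀ s ∈ S, Covered ρ (Subgroup.closure S) I x (ρ s x) ∧
      Covered ρ (Subgroup.closure S) I x (ρ s⁻¹ x)) {g : G} (hg : g ∈ Subgroup.closure S) :
    Covered ρ (Subgroup.closure S) I x (ρ g x) := by
  suffices hboth : Covered ρ (Subgroup.closure S) I x (ρ g x) ∧
      Covered ρ (Subgroup.closure S) I x (ρ g⁻¹ x) from hboth.1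
  induction hg using Subgroup.closure_induction with
  | mem s hs => exact h s hs
  | one => simpa using Covered.of_le (ρ := ρ) le_rfl
  | mul g k hg hk ihg ihk =>
    rw [mul_inv_rev, act_mul, act_mul]
    exact ⟨ihg.1.trans (ihk.1.act hg), ihk.2.trans (ihg.2.act (inv_mem hk))⟩
  | inv g hg ih =>
    rw [inv_inv]
    exact ih.symm

lemma exists_zpow_act_unbounded {N : Subgroup G} (hN : N.Normal) {x : ℝ}
    (hgrowth : SubexpOrbitGrowth ρ N x) {T f : G} (hT : ∀ y, y < ρ T y) (hf : f ∈ N)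
    (hTf : ρ T x ≤ ρ f x) :
    (∀ y, ∃ k : ℤ, y < ρ (f ^ k) x) ∧ (∀ y, ∃ k : ℤ, ρ (f ^ k) x < y) := by
  set f₁ := T * f * T⁻¹ with hf₁
  have hf₁N : f₁ ∈ N := hN.conj_mem f hf T
  have hf₁pow : ∀ k : ℤ, ρ (f₁ ^ k) (ρ T x) = ρ T (ρ (f ^ k) x) := by
    intro k
    rw [hf₁, conj_zpow, ← act_mul, inv_mul_cancel_right, act_mul]
  set H := Subgroup.closure {f, f₁} with hH
  have hfH : f ∈ H := Subgroup.subset_closure (by simp)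
  have hf₁H : f₁ ∈ H := Subgroup.subset_closure (by simp)
  have hHN : H ≤ N := by
    rw [hH, Subgroup.closure_le]
    rintro g (rfl | rfl)
    exacts [hf, hf₁N]
  have hxf : x < ρ f x := (hT x).trans_le hTf
  set M := max (ρ f x) (max (ρ f₁ x) (ρ f₁⁻¹ x)) with hM
  have hxM : x < M := hxf.trans_le (le_max_left _ _)
  have hcov : ∀ g ∈ H, Covered ρ H (Set.Ico x M) x (ρ g x) := by
    intro g hg
    refine covered_act_of_mem_closure ?_ hg
    have hle : ∀ y, y ≤ M → Covered ρ H (Set.Ico x M) x y := fun y hy =>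
      .of_subset (Set.Ico_subset_Ico_right hy)
    rintro s (rfl | rfl)
    · refine ⟨hle _ (le_max_left _ _), .of_le ?_⟩
      have := (ρ s⁻¹).monotone hxf.le
      rwa [act_inv_act] at this
    · exact ⟨hle _ ((le_max_left _ _).trans (le_max_right _ _)),
        hle _ ((le_max_right _ _).trans (le_max_right _ _))⟩
  obtain ⟨φ, τ, hmono, hφ, hφM⟩ := exists_semiconj_translation ρ hxM (hgrowth.mono hHN) hcov
  set J := coveredSet ρ H (Set.Ico x M) x with hJ
  have hxJ : x ∈ J := self_mem_coveredSet
  have hact : ∀ g ∈ H, ∀ y ∈ J, ρ g y ∈ J := fun g hg y hy => act_mem_coveredSet hcov hg hy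
  have hfx : ρ f x ∈ J := hact f hfH x hxJ
  have hTx : ρ T x ∈ J := mem_coveredSet_of_le hxJ hfx (hT x).le hTf
  have hpowJ : ∀ k : ℤ, ρ (f ^ k) x ∈ J := fun k => hact _ (H.zpow_mem hfH k) x hxJ
  have hpow₁J : ∀ k : ℤ, ρ (f₁ ^ k) (ρ f x) ∈ J := fun k => hact _ (H.zpow_mem hf₁H k) _ hfx
  have hτf : 0 ≤ τ f := by
    have h1 := hmono hxJ hfx hxf.le
    rw [hφ f hfH x hxJ] at h1
    linarith
  have hτf₁ : 0 ≤ τ f₁ := by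
    have h1 : ρ T x ≤ ρ f₁ (ρ T x) := by
      have := hf₁pow 1
      rw [zpow_one, zpow_one] at this
      rw [this]
      exact (ρ T).monotone hxf.le
    have h2 := hmono hTx (hact _ hf₁H _ hTx) h1
    rw [hφ f₁ hf₁H _ hTx] at h2
    linarith
  have hnot : ¬ (τ f = 0 ∧ τ f₁ = 0) := by
    rintro ⟨h1, h2⟩
    have h3 := hφ f hfH x hxJ
    have h4 := hφ f₁ hf₁H x hxJ
    have h5 := hφ f₁ hf₁H _ (hact f₁⁻¹ (H.inv_mem hf₁H) x hxJ)
    rw [act_act_inv] at h5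
    have h6 : φ M = φ x := by
      rw [hM]
      rcases max_choice (ρ f x) (max (ρ f₁ x) (ρ f₁⁻¹ x)) with h | h
      · rw [h]; linarith
      · rw [h]
        rcases max_choice (ρ f₁ x) (ρ f₁⁻¹ x) with h | h <;> rw [h] <;> linarith
    linarith
  set s := Set.range fun k : ℤ => ρ (f ^ k) x with hs
  have hsne : s.Nonempty := Set.range_nonempty _
  have hfs : ρ f '' s = s := by
    ext y
    constructor
    · rintro ⟨_, ⟨k, rfl⟩, rfl⟩
      exact ⟨1 + k, by simp only [zpow_one_add, act_mul]⟩
    · rintro ⟨k, rfl⟩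
      refine ⟨_, ⟨-1 + k, rfl⟩, ?_⟩
      simp only
      rw [← act_mul, ← zpow_one_add, add_neg_cancel_left]
  have habove : ∀ (y : ℝ) (k : ℤ), y < ρ T (ρ (f ^ k) x) → y ≤ ρ (f₁ ^ k) (ρ f x) := by
    intro y k hy
    rw [← hf₁pow] at hy
    exact hy.le.trans ((ρ (f₁ ^ k)).monotone hTf)
  have hTinv : ∀ y z, ρ T⁻¹ y < z → y < ρ T z := by
    intro y z h
    have := (ρ T).strictMono h
    rwa [act_act_inv] at this
  have hfA : BddAbove s → τ f = 0 := by
    intro hb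
    have hfix : ρ f (sSup s) = sSup s := by
      rw [(ρ f).map_csSup' hsne hb, hfs]
    have hlt : ρ T⁻¹ (sSup s) < sSup s := by
      have := hT (ρ T⁻¹ (sSup s))
      rwa [act_act_inv] at this
    obtain ⟨_, ⟨k, rfl⟩, hk⟩ := exists_lt_of_lt_csSup hsne hlt
    have hbJ : sSup s ∈ J := mem_coveredSet_of_le (hpowJ 0) (hpow₁J k)
      (le_csSup hb ⟨0, rfl⟩) (habove _ _ (hTinv _ _ hk))
    have := hφ f hfH _ hbJ
    rw [hfix] at this
    linarith
  have hfB : BddBelow s → τ f₁ = 0 := by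
    intro hb
    have hfix : ρ f (sInf s) = sInf s := by
      rw [(ρ f).map_csInf' hsne hb, hfs]
    have hfix₁ : ρ f₁ (ρ T (sInf s)) = ρ T (sInf s) := by
      rw [← act_mul, hf₁, inv_mul_cancel_right, act_mul, hfix]
    obtain ⟨_, ⟨k, rfl⟩, hk⟩ := exists_lt_of_csInf_lt hsne (hT (sInf s))
    have hx0 : sInf s ≤ x := by
      have : sInf s ≤ ρ (f ^ (0 : ℤ)) x := csInf_le hb ⟨0, rfl⟩
      rwa [zpow_zero, act_one] at this
    have haJ : ρ T (sInf s) ∈ J := mem_coveredSet_of_le (hpowJ k) hTx hk.le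
      ((ρ T).monotone hx0)
    have := hφ f₁ hf₁H _ haJ
    rw [hfix₁] at this
    linarith
  have hfA' : ¬ BddAbove s → τ f₁ = 0 → τ f = 0 := by
    intro hb h0
    obtain ⟨_, ⟨k, rfl⟩, hk⟩ := not_bddAbove_iff.1 hb (ρ T⁻¹ (ρ (f ^ (2 : ℤ)) x))
    have h1 := hmono (hpowJ 2) (hpow₁J k) (habove _ _ (hTinv _ _ hk))
    rw [semiconj_zpow hact hφ hfH hxJ, semiconj_zpow hact hφ hf₁H hfx, hφ f hfH x hxJ, h0] at h1
    push_cast at h1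
    linarith
  have hfB' : ¬ BddBelow s → τ f = 0 → τ f₁ = 0 := by
    intro hb h0
    obtain ⟨_, ⟨k, rfl⟩, hk⟩ := not_bddBelow_iff.1 hb (ρ (f₁ ^ (-1 : ℤ)) x)
    have h1 := hmono (hpowJ k) (hact _ (H.zpow_mem hf₁H (-1)) x hxJ) hk.le
    rw [semiconj_zpow hact hφ hfH hxJ, semiconj_zpow hact hφ hf₁H hxJ, h0] at h1
    push_cast at h1
    linarith
  have hA : ¬ BddAbove s := by tauto
  have hB : ¬ BddBelow s := by tauto
  refine ⟨fun y => ?_, fun y => ?_⟩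
  · obtain ⟨_, ⟨k, rfl⟩, hk⟩ := not_bddAbove_iff.1 hA y
    exact ⟨k, hk⟩
  · obtain ⟨_, ⟨k, rfl⟩, hk⟩ := not_bddBelow_iff.1 hB y
    exact ⟨k, hk⟩

lemma Covered.mono_subgroup {H K : Subgroup G} (hHK : H ≤ K) {I : Set ℝ} {a b : ℝ}
    (h : Covered ρ H I a b) : Covered ρ K I a b := by
  obtain ⟨s, hs, hsub⟩ := h
  exact ⟨s, fun g hg => hHK (hs g hg), hsub⟩

/-- If some `f ∈ N` moves `x` off to both ends of the line, then `N` is semiconjugate to a group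
of translations. -/
lemma exists_semiconj_translation_of_unbounded {N : Subgroup G} {x : ℝ}
    (hgrowth : SubexpOrbitGrowth ρ N x) {f : G} (hf : f ∈ N) (hxf : x < ρ f x)
    (hup : ∀ y, ∃ k : ℤ, y < ρ (f ^ k) x) (hdown : ∀ y, ∃ k : ℤ, ρ (f ^ k) x < y) :
    ∃ φ τ : _ → ℝ, Monotone φ ∧ (∀ n ∈ N, ∀ y, φ (ρ n y) = φ y + τ n) ∧ τ f = 1 := by
  set I := Set.Ico x (ρ f x) with hI
  have hpow : ∀ k : ℤ, Covered ρ N I x (ρ (f ^ k) x) := by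
    intro k
    have hfk : f ^ k ∈ Subgroup.closure {f} :=
      zpow_mem (Subgroup.subset_closure (Set.mem_singleton f)) k
    refine (covered_act_of_mem_closure ?_ hfk).mono_subgroup
      ((Subgroup.closure_le N).2 (Set.singleton_subset_iff.2 hf))
    rintro s rfl
    refine ⟨.of_subset le_rfl, .of_le ?_⟩
    have := (ρ s⁻¹).monotone hxf.le
    rwa [act_inv_act] at this
  have hall : ∀ a b, Covered ρ N I a b := by
    intro a b
    obtain ⟨k, hk⟩ := hdown a
    obtain ⟨l, hl⟩ := hup b
    have h1 := (hpow (-k)).act (N.zpow_mem hf k)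
    rw [← act_mul, ← zpow_add, add_neg_cancel, zpow_zero, act_one] at h1
    exact (h1.trans (hpow l)).mono hk.le hl.le
  obtain ⟨φ, τ, h1, h2, h3⟩ :=
    exists_semiconj_translation ρ hxf hgrowth fun g _ => hall _ _
  have huniv : ∀ y, y ∈ coveredSet ρ N I x := fun y => ⟨hall _ _, hall _ _⟩
  refine ⟨φ, τ, fun a b hab => h1 (huniv a) (huniv b) hab, fun n hn y => h2 n hn y (huniv y), ?_⟩
  have h4 := h2 f hf x (huniv x)
  linarith

lemma exists_act_ge {N : Subgroup G} {F : Set ℝ} (hF : IsClosed F)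
    (hinv : ∀ n ∈ N, ∀ y ∈ F, ρ n y ∈ F) (hfix : ∀ y ∈ F, ∃ n ∈ N, ρ n y ≠ y) {x : ℝ}
    (hx : x ∈ F) (y : ℝ) : ∃ n ∈ N, y ≤ ρ n x := by
  by_contra! hcon
  set s : Set ℝ := {z | ∃ n ∈ N, ρ n x = z} with hs
  have hsne : s.Nonempty := ⟨x, 1, N.one_mem, act_one ρ x⟩
  have hsF : s ⊆ F := by
    rintro _ ⟨n, hn, rfl⟩
    exact hinv n hn x hx
  have hb : BddAbove s := ⟨y, by rintro _ ⟨n, hn, rfl⟩; exact (hcon n hn).le⟩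
  obtain ⟨n, hn, hne⟩ := hfix _ (closure_minimal hsF hF (csSup_mem_closure hsne hb))
  refine hne ?_
  rw [(ρ n).map_csSup' hsne hb]
  congr 1
  ext z
  constructor
  · rintro ⟨_, ⟨m, hm, rfl⟩, rfl⟩
    exact ⟨n * m, N.mul_mem hn hm, act_mul ρ n m x⟩
  · rintro ⟨m, hm, rfl⟩
    refine ⟨_, ⟨n⁻¹ * m, N.mul_mem (N.inv_mem hn) hm, rfl⟩, ?_⟩
    rw [← act_mul, mul_inv_cancel_left]

lemma forall_lt_act_or_forall_lt_act_inv {T : G} (hT : ∀ y, ρ T y ≠ y) :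
    (∀ y, y < ρ T y) ∨ ∀ y, y < ρ T⁻¹ y := by
  by_contra! hcon
  obtain ⟨⟨a, ha⟩, b, hb⟩ := hcon
  have hb' : b ≤ ρ T b := by
    have := (ρ T).monotone hb
    rwa [act_act_inv] at this
  have hc : Continuous fun y => ρ T y - y := (ρ T).continuous.sub continuous_id
  obtain ⟨c, hc0⟩ := mem_range_of_exists_le_of_exists_ge hc ⟨a, sub_nonpos.2 ha⟩
    ⟨b, sub_nonneg.2 hb'⟩
  exact hT c (sub_eq_zero.1 hc0)

/-- A monotone map semiconjugating `N` to translations with translation lengths `τ`. -/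
structure IsTranslationMap (ρ : G →* (ℝ ≃o ℝ)) (N : Subgroup G) (φ : ℝ → ℝ) (τ : G → ℝ) :
    Prop where
  monotone : Monotone φ
  map_act : ∀ n ∈ N, ∀ y, φ (ρ n y) = φ y + τ n

namespace IsTranslationMap

variable {N : Subgroup G} {φ : ℝ → ℝ} {τ : G → ℝ}

lemma map_mul (h : IsTranslationMap ρ N φ τ) {m n : G} (hm : m ∈ N) (hn : n ∈ N) :
    τ (m * n) = τ m + τ n := by
  have h1 := h.map_act _ (N.mul_mem hm hn) 0
  rw [act_mul, h.map_act m hm, h.map_act n hn] at h1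
  linarith

lemma map_act_zpow (h : IsTranslationMap ρ N φ τ) {n : G} (hn : n ∈ N) (k : ℤ) (y : ℝ) :
    φ (ρ (n ^ k) y) = φ y + k * τ n :=
  semiconj_zpow (J := Set.univ) (fun _ _ _ _ => Set.mem_univ _) (fun n hn y _ => h.map_act n hn y)
    hn (Set.mem_univ y) k

lemma map_zpow (h : IsTranslationMap ρ N φ τ) {n : G} (hn : n ∈ N) (k : ℤ) :
    τ (n ^ k) = k * τ n := by
  have h1 := h.map_act_zpow hn k 0
  rw [h.map_act _ (N.zpow_mem hn k)] at h1
  linarith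

lemma map_inv (h : IsTranslationMap ρ N φ τ) {n : G} (hn : n ∈ N) : τ n⁻¹ = -τ n := by
  have := h.map_zpow hn (-1)
  rw [zpow_neg_one] at this
  rw [this]; push_cast; ring

lemma lt_act (h : IsTranslationMap ρ N φ τ) {n : G} (hn : n ∈ N) (hpos : 0 < τ n) (y : ℝ) :
    y < ρ n y := by
  by_contra! hle
  have := h.monotone hle
  rw [h.map_act n hn] at this
  linarith

lemma conj_pos (h : IsTranslationMap ρ N φ τ) (hN : N.Normal) {f : G} (hf : f ∈ N)
    (hτf : τ f = 1) (g : G) {n : G} (hn : n ∈ N) (hpos : 0 < τ n) : 0 < τ (g * n * g⁻¹) := by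
  have hgn : g * n * g⁻¹ ∈ N := hN.conj_mem n hn g
  have hnonneg : 0 ≤ τ (g * n * g⁻¹) := by
    have h1 : (0 : ℝ) ≤ ρ (g * n * g⁻¹) 0 := by
      have := (ρ g).monotone (h.lt_act hn hpos (ρ g⁻¹ 0)).le
      rwa [act_act_inv, ← act_mul, ← act_mul] at this
    have h2 := h.monotone h1
    rw [h.map_act _ hgn] at h2
    linarith
  refine hnonneg.lt_of_ne fun h0 => ?_
  obtain ⟨k, hk⟩ := exists_nat_gt ((φ (ρ g⁻¹ (ρ f 0)) - φ (ρ g⁻¹ 0)) / τ n)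
  rw [div_lt_iff₀ hpos] at hk
  have h1 : ρ g⁻¹ (ρ f 0) ≤ ρ (n ^ (k : ℤ)) (ρ g⁻¹ 0) := by
    by_contra! hlt
    have := h.monotone hlt.le
    rw [h.map_act_zpow hn] at this
    push_cast at this
    linarith
  have h2 := (ρ g).monotone h1
  rw [act_act_inv, ← act_mul, ← act_mul, ← conj_zpow] at h2
  have h3 := h.monotone h2
  rw [h.map_act_zpow hgn, ← h0, h.map_act f hf, hτf] at h3
  linarith

/-- Conjugation by `g` rescales translation lengths. -/
lemma exists_conj_eq_mul (h : IsTranslationMap ρ N φ τ) (hN : N.Normal) {f : G} (hf : f ∈ N)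
    (hτf : τ f = 1) (g : G) : ∃ l : ℝ, 0 < l ∧ ∀ n ∈ N, τ (g * n * g⁻¹) = l * τ n := by
  have hl : 0 < τ (g * f * g⁻¹) := h.conj_pos hN hf hτf g hf (by rw [hτf]; exact one_pos)
  refine ⟨τ (g * f * g⁻¹), hl, ?_⟩
  have hle : ∀ n ∈ N, τ (g * f * g⁻¹) * τ n ≤ τ (g * n * g⁻¹) := by
    intro n hn
    by_contra! hlt
    rw [← div_lt_iff₀' hl] at hlt
    obtain ⟨r, hr1, hr2⟩ := exists_rat_btwn hlt
    have hden : (0 : ℝ) < r.den := by exact_mod_cast r.den_pos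
    rw [Rat.cast_def, lt_div_iff₀ hden, div_mul_eq_mul_div, div_lt_iff₀ hl] at hr1
    rw [Rat.cast_def, div_lt_iff₀ hden] at hr2
    have hnq := N.zpow_mem hn (r.den : ℤ)
    have hfp := N.zpow_mem hf (-r.num)
    have h1 : 0 < τ (n ^ (r.den : ℤ) * f ^ (-r.num)) := by
      rw [h.map_mul hnq hfp, h.map_zpow hn, h.map_zpow hf, hτf]
      push_cast
      linarith
    have h2 := h.conj_pos hN hf hτf g (N.mul_mem hnq hfp) h1
    rw [← conj_mul, ← conj_zpow, ← conj_zpow,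
      h.map_mul (N.zpow_mem (hN.conj_mem n hn g) _) (N.zpow_mem (hN.conj_mem f hf g) _),
      h.map_zpow (hN.conj_mem n hn g), h.map_zpow (hN.conj_mem f hf g)] at h2
    push_cast at h2
    linarith
  intro n hn
  refine le_antisymm ?_ (hle n hn)
  have h1 := hle n⁻¹ (N.inv_mem hn)
  rw [← conj_inv, h.map_inv hn, h.map_inv (hN.conj_mem n hn g)] at h1
  linarith

lemma sub_le_sub_of_dense (h : IsTranslationMap ρ N φ τ) {ψ : ℝ → ℝ}
    (hψ : IsTranslationMap ρ N ψ τ) (hd : Dense (τ '' N)) (x y : ℝ) :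
    φ y - φ x ≤ ψ y - ψ x := by
  by_contra! hlt
  obtain ⟨_, ⟨n, hn, rfl⟩, h1, h2⟩ := hd.exists_between hlt
  have h3 : ρ n x < y := by
    by_contra! hle
    have := h.monotone hle
    rw [h.map_act n hn] at this
    linarith
  have h4 := hψ.monotone h3.le
  rw [hψ.map_act n hn] at h4
  linarith

/-- If the translation lengths are dense, then the whole ambient group acts by affine maps. -/
lemma exists_affine_of_dense (h : IsTranslationMap ρ N φ τ) (hN : N.Normal) {f : G} (hf : f ∈ N)
    (hτf : τ f = 1) (hd : Dense (τ '' N)) (g : G) :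
    ∃ l : ℝ, 0 < l ∧ ∃ c : ℝ, ∀ y, φ (ρ g y) = l * φ y + c := by
  obtain ⟨l, hl, hconj⟩ := h.exists_conj_eq_mul hN hf hτf g
  have hψ : IsTranslationMap ρ N (fun y => φ (ρ g y) / l) τ := by
    refine ⟨fun a b hab => ?_, fun n hn y => ?_⟩
    · exact div_le_div_of_nonneg_right (h.monotone ((ρ g).monotone hab)) hl.le
    · have h1 := h.map_act _ (hN.conj_mem n hn g) (ρ g y)
      rw [← act_mul, inv_mul_cancel_right, act_mul, hconj n hn] at h1
      rw [h1]
      field_simp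
  refine ⟨l, hl, φ (ρ g 0) - l * φ 0, fun y => ?_⟩
  have h1 := h.sub_le_sub_of_dense hψ hd 0 y
  have h2 := hψ.sub_le_sub_of_dense h hd 0 y
  have h3 : φ (ρ g y) / l - φ (ρ g 0) / l = φ y - φ 0 := le_antisymm h2 h1
  field_simp at h3
  linarith

end IsTranslationMap

lemma exists_quasiInvariant_measure_of_affine {φ : ℝ → ℝ} (hφ : Monotone φ) {a b : ℝ}
    (hab : φ a < φ b)
    (haff : ∀ g, ∃ l : ℝ, 0 < l ∧ ∃ c : ℝ, ∀ y, φ (ρ g y) = l * φ y + c) :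
    ∃ μ : Measure ℝ, μ ≠ 0 ∧ IsRadon μ ∧ ∀ g : G, ∃ lam : ℝ, 0 < lam ∧
      Measure.map (⇑(ρ g)) μ = ENNReal.ofReal lam • μ := by
  set Φ := hφ.stieltjesFunction
  refine ⟨Φ.measure, ?_, fun K hK => hK.measure_lt_top, fun g => ?_⟩
  · intro h0
    have h1 := Φ.measure_Ioc (a - 1) b
    rw [h0, Measure.coe_zero, Pi.zero_apply, eq_comm, ENNReal.ofReal_eq_zero] at h1
    have h2 : Φ (a - 1) ≤ φ a := hφ.rightLim_le (sub_one_lt a)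
    have h3 : φ b ≤ Φ b := hφ.le_rightLim le_rfl
    linarith
  · obtain ⟨l, hl, c, hc⟩ := haff g
    have hΦg : ∀ y, Φ (ρ g y) = l * Φ y + c := by
      intro y
      have hg : Filter.Tendsto (ρ g) (nhdsWithin y (Set.Ioi y))
          (nhdsWithin (ρ g y) (Set.Ioi (ρ g y))) :=
        tendsto_nhdsWithin_iff.2 ⟨(ρ g).continuous.continuousAt.mono_left nhdsWithin_le_nhds,
          Filter.eventually_of_mem self_mem_nhdsWithin fun z hz => (ρ g).strictMono hz⟩
      have h1 := (hφ.tendsto_rightLim (ρ g y)).comp hg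
      have h2 := ((hφ.tendsto_rightLim y).const_mul l).add_const c
      exact tendsto_nhds_unique h1 (h2.congr fun z => (hc z).symm)
    refine ⟨l⁻¹, inv_pos.2 hl, Eq.symm (Measure.ext_of_Ioc' _ _ ?_ ?_)⟩
    · intro u v _
      rw [Measure.smul_apply, Φ.measure_Ioc]
      exact ENNReal.mul_ne_top ENNReal.ofReal_ne_top ENNReal.ofReal_ne_top
    · intro u v _
      have hpre : ρ g ⁻¹' Set.Ioc u v = Set.Ioc (ρ g⁻¹ u) (ρ g⁻¹ v) := by
        rw [map_inv]
        exact (ρ g).preimage_Ioc u v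
      rw [Measure.map_apply (ρ g).continuous.measurable measurableSet_Ioc, hpre,
        Measure.smul_apply, Φ.measure_Ioc, Φ.measure_Ioc, smul_eq_mul,
        ← ENNReal.ofReal_mul (inv_pos.2 hl).le]
      congr 1
      have h1 := hΦg (ρ g⁻¹ u)
      have h2 := hΦg (ρ g⁻¹ v)
      rw [act_act_inv] at h1 h2
      rw [h1, h2]
      field_simp
      ring

lemma LocallySubexponentialGrowth.eventually_ncard_pow_le {Q : Type*} [Group Q]
    (hQ : LocallySubexponentialGrowth Q) {S : Set Q} (hS : S.Finite) (hone : 1 ∈ S)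
    (hsymm : ∀ s ∈ S, s⁻¹ ∈ S) {c : ℝ} (hc : 1 < c) :
    ∀ᶠ n in Filter.atTop, ((S ^ n).ncard : ℝ) ≤ c ^ n := by
  set K := Subgroup.closure S with hK
  have hfg : K.FG := ⟨hS.toFinset, by simp [hK]⟩
  have himg : K.subtype '' (K.subtype ⁻¹' S) = S := by
    refine Set.image_preimage_eq_of_subset ?_
    exact fun s hs => ⟨⟨s, Subgroup.subset_closure hs⟩, rfl⟩
  filter_upwards [hQ K hfg (K.subtype ⁻¹' S) (hS.preimage Subtype.val_injective.injOn) hone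
    (fun s hs => hsymm s hs) Subgroup.closure_closure_coe_preimage c hc] with n hn
  rwa [← himg, ← Set.image_pow, Set.ncard_image_of_injective _ K.subtype_injective,
    ← Nat.card_coe_set_eq]

lemma eventually_linear_mul_sqrt_pow_le (M : ℕ) {c : ℝ} (hc : 1 < c) :
    ∀ᶠ n : ℕ in Filter.atTop, √c ^ n * (2 * (M * n) + 1) ≤ c ^ n := by
  have hr : 1 < √c := (Real.lt_sqrt zero_le_one).2 (by rwa [one_pow])
  have h1 := ((isLittleO_coe_const_pow_of_one_lt (R := ℝ) hr).const_mul_left (2 * M : ℝ)).add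
    (isLittleO_pow_pow_of_lt_left zero_le_one hr)
  filter_upwards [h1.def one_pos] with n hn
  rw [one_mul, one_pow, Real.norm_of_nonneg (by positivity), Real.norm_of_nonneg (by positivity)]
    at hn
  have h2 : c ^ n = √c ^ n * √c ^ n := by
    rw [← mul_pow, Real.mul_self_sqrt (by linarith)]
  rw [h2]
  gcongr
  linarith

/-- Subexponential growth of orbits passes to `H` from the quotient `H ⧸ N`, provided that elements
of a ball lying in the same coset move `x` to points differing by a linearly bounded power
of `t`. -/
lemma SubexpOrbitGrowth.of_quotient {H N : Subgroup G} [hN : N.Normal]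
    (hQ : LocallySubexponentialGrowth (↥H ⧸ N.subgroupOf H)) {x : ℝ} (t : G)
    (hcoset : ∀ S : Set G, S.Finite → ∃ M : ℕ, ∀ n : ℕ, ∀ γ ∈ S ^ n, ∀ γ' ∈ S ^ n, γ' * γ⁻¹ ∈ N →
      ∃ k : ℤ, |k| ≤ M * n ∧ ρ γ' x = ρ (t ^ k) (ρ γ x)) :
    SubexpOrbitGrowth ρ H x := by
  intro S hS hone hsymm hSH c hc
  obtain ⟨M, hM⟩ := hcoset S hS
  set π := QuotientGroup.mk' (N.subgroupOf H)
  set S₁ : Set H := H.subtype ⁻¹' S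
  have himg : ∀ n, H.subtype '' (S₁ ^ n) = S ^ n := by
    intro n
    rw [Set.image_pow, Set.image_preimage_eq_of_subset]
    exact fun s hs => ⟨⟨s, hSH hs⟩, rfl⟩
  have hS₁fin : S₁.Finite := hS.preimage Subtype.val_injective.injOn
  have hr : 1 < √c := (Real.lt_sqrt zero_le_one).2 (by rwa [one_pow])
  have hpow : ∀ n, (S₁ ^ n).Finite := by
    intro n
    induction n with
    | zero => simp
    | succ n ih => rw [pow_succ]; exact ih.mul hS₁fin
  filter_upwards [hQ.eventually_ncard_pow_le (hS₁fin.image π) ⟨1, hone, map_one π⟩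
    (by rintro _ ⟨s, hs, rfl⟩; exact ⟨s⁻¹, hsymm s hs, map_inv π s⟩) hr,
    eventually_linear_mul_sqrt_pow_le M hc] with n hn hlin
  rw [← Set.image_pow] at hn
  set E := π '' (S₁ ^ n) with hE
  have hEfin : E.Finite := (hpow n).image π
  set rep := Function.invFunOn π (S₁ ^ n)
  set J : Set ℤ := Set.Icc (-(M * n)) (M * n) with hJ
  have hJcard : J.ncard = 2 * (M * n) + 1 := by
    rw [hJ, ← Finset.coe_Icc, Set.ncard_coe_finset, Int.card_Icc]
    have : ((M * n : ℕ) : ℤ) = (M : ℤ) * n := by push_cast; ring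
    rw [← this]
    omega
  have hsub : (fun g => ρ g x) '' (S ^ n) ⊆
      (fun p : _ × ℤ => ρ (t ^ p.2) (ρ (rep p.1 : G) x)) '' (E ×ˢ J) := by
    rintro _ ⟨γ', hγ', rfl⟩
    rw [← himg n] at hγ'
    obtain ⟨a, ha, rfl⟩ := hγ'
    have hex : ∃ b ∈ S₁ ^ n, π b = π a := ⟨a, ha, rfl⟩
    have hmem := Function.invFunOn_mem hex
    have heq := Function.invFunOn_eq hex
    have hNmem : (a : G) * (rep (π a) : G)⁻¹ ∈ N := by
      have h1 := QuotientGroup.eq.1 heq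
      exact hN.mem_comm (Subgroup.mem_subgroupOf.1 h1)
    obtain ⟨k, hk, hkx⟩ := hM n (rep (π a)) (by rw [← himg n]; exact ⟨_, hmem, rfl⟩) a
      (by rw [← himg n]; exact ⟨_, ha, rfl⟩) hNmem
    exact ⟨(π a, k), ⟨⟨a, ha, rfl⟩, abs_le.1 hk⟩, hkx.symm⟩
  have hJfin : J.Finite := Set.finite_Icc _ _
  have hcard : ((fun g => ρ g x) '' (S ^ n)).ncard ≤ E.ncard * (2 * (M * n) + 1) := by
    refine (Set.ncard_le_ncard hsub ((hEfin.prod hJfin).image _)).trans ?_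
    refine (Set.ncard_image_le (hEfin.prod hJfin)).trans ?_
    rw [Set.ncard_prod, hJcard]
  calc (((fun g => ρ g x) '' (S ^ n)).ncard : ℝ)
      ≤ E.ncard * (2 * (M * n) + 1) := by exact_mod_cast hcard
    _ ≤ √c ^ n * (2 * (M * n) + 1) := by gcongr
    _ ≤ c ^ n := hlin

namespace IsTranslationMap

variable {N : Subgroup G} {φ : ℝ → ℝ} {τ : G → ℝ}

lemma map_conj_of_cyclic (h : IsTranslationMap ρ N φ τ) (hN : N.Normal) {f : G} (hf : f ∈ N)
    (hτf : τ f = 1) {t : G} (ht : t ∈ N) (htpos : 0 < τ t)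
    (hcyc : ∀ n ∈ N, ∃ k : ℤ, τ n = k * τ t) (g : G) {n : G} (hn : n ∈ N) :
    τ (g * n * g⁻¹) = τ n := by
  have hint : ∀ g : G, ∃ k : ℤ, 0 < k ∧ ∀ n ∈ N, τ (g * n * g⁻¹) = k * τ n := by
    intro g
    obtain ⟨l, hl, hconj⟩ := h.exists_conj_eq_mul hN hf hτf g
    obtain ⟨k, hk⟩ := hcyc _ (hN.conj_mem t ht g)
    rw [hconj t ht] at hk
    have hlk : l = k := mul_right_cancel₀ htpos.ne' hk
    subst hlk
    exact ⟨k, by exact_mod_cast hl, hconj⟩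
  obtain ⟨k, hk, h1⟩ := hint g
  obtain ⟨m, hm, h2⟩ := hint g⁻¹
  have h3 := h2 _ (hN.conj_mem t ht g)
  rw [h1 t ht, show g⁻¹ * (g * t * g⁻¹) * g⁻¹⁻¹ = t by group, ← mul_assoc] at h3
  have h4 : (m : ℝ) * k = 1 := mul_right_cancel₀ htpos.ne' (by rw [← h3, one_mul])
  have h5 : m * k = 1 := by exact_mod_cast h4
  have h6 : k = 1 := Int.eq_one_of_mul_eq_one_left hk.le h5
  rw [h1 n hn, h6, Int.cast_one, one_mul]

lemma abs_map_act_sub_le (h : IsTranslationMap ρ N φ τ) (hN : N.Normal) {f : G} (hf : f ∈ N)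
    (hτf : τ f = 1) {t : G} (ht : t ∈ N) (htpos : 0 < τ t)
    (hcyc : ∀ n ∈ N, ∃ k : ℤ, τ n = k * τ t) (g : G) (y : ℝ) :
    |φ (ρ g y) - φ y| ≤ |φ (ρ g 0) - φ 0| + 2 * τ t := by
  have hact : ∀ (k : ℤ) z, φ (ρ g (ρ (t ^ k) z)) = φ (ρ g z) + k * τ t := by
    intro k z
    have h1 := h.map_act_zpow (hN.conj_mem t ht g) k (ρ g z)
    rwa [h.map_conj_of_cyclic hN hf hτf ht htpos hcyc g ht, conj_zpow, ← act_mul,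
      inv_mul_cancel_right, act_mul] at h1
  set k : ℤ := ⌊(φ y - φ 0) / τ t⌋ with hk
  have hk1 : k * τ t ≤ φ y - φ 0 := (le_div_iff₀ htpos).1 (Int.floor_le _)
  have hk2 : φ y - φ 0 < (k + 1) * τ t := (div_lt_iff₀ htpos).1 (Int.lt_floor_add_one _)
  have h1 : ρ (t ^ (k - 1)) 0 ≤ y := by
    by_contra! hlt
    have := h.monotone hlt.le
    rw [h.map_act_zpow ht] at this
    push_cast at this
    linarith
  have h2 : y ≤ ρ (t ^ (k + 1)) 0 := by
    by_contra! hlt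
    have := h.monotone hlt.le
    rw [h.map_act_zpow ht] at this
    push_cast at this
    linarith
  have h3 := h.monotone ((ρ g).monotone h1)
  have h4 := h.monotone ((ρ g).monotone h2)
  rw [hact] at h3 h4
  push_cast at h3 h4
  have h5 := abs_le.1 (le_refl |φ (ρ g 0) - φ 0|)
  rw [abs_le]
  constructor <;> linarith

lemma exists_abs_map_act_sub_le_mul (h : IsTranslationMap ρ N φ τ) (hN : N.Normal) {f : G}
    (hf : f ∈ N) (hτf : τ f = 1) {t : G} (ht : t ∈ N) (htpos : 0 < τ t)
    (hcyc : ∀ n ∈ N, ∃ k : ℤ, τ n = k * τ t) {S : Set G} (hS : S.Finite) :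
    ∃ C : ℝ, ∀ n : ℕ, ∀ γ ∈ S ^ n, ∀ y, |φ (ρ γ y) - φ y| ≤ C * n := by
  obtain ⟨C, hC⟩ := (hS.image fun g => |φ (ρ g 0) - φ 0| + 2 * τ t).bddAbove
  refine ⟨C, fun n => ?_⟩
  induction n with
  | zero =>
    intro γ hγ y
    rw [pow_zero, Set.mem_one] at hγ
    simp [hγ]
  | succ n ih =>
    intro γ hγ y
    rw [pow_succ] at hγ
    obtain ⟨a, ha, s, hs, rfl⟩ := Set.mem_mul.1 hγ
    have h1 := ih a ha (ρ s y)
    have h2 := (h.abs_map_act_sub_le hN hf hτf ht htpos hcyc s y).trans (hC ⟨s, hs, rfl⟩)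
    rw [act_mul]
    have h3 := abs_sub_le (φ (ρ a (ρ s y))) (φ (ρ s y)) (φ y)
    push_cast
    linarith

lemma exists_fixed_mem (h : IsTranslationMap ρ N φ τ) {f : G} (hf : f ∈ N) (hτf : τ f = 1)
    {F : Set ℝ} (hF : IsClosed F) (hinv : ∀ n ∈ N, ∀ y ∈ F, ρ n y ∈ F) {x : ℝ} (hx : x ∈ F) :
    ∃ z ∈ F, ∀ n ∈ N, τ n = 0 → ρ n z = z := by
  set s : Set ℝ := {y | y ∈ F ∧ φ y ≤ φ x} with hs
  have hsne : s.Nonempty := ⟨x, hx, le_rfl⟩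
  have hb : BddAbove s := by
    refine ⟨ρ f x, fun y hy => ?_⟩
    by_contra! hlt
    have h1 := h.monotone hlt.le
    rw [h.map_act f hf, hτf] at h1
    linarith [hy.2]
  refine ⟨sSup s, closure_minimal (fun y hy => hy.1) hF (csSup_mem_closure hsne hb),
    fun n hn h0 => ?_⟩
  have hsub : ∀ m ∈ N, τ m = 0 → ∀ y ∈ s, ρ m y ∈ s := fun m hm hm0 y hy =>
    ⟨hinv m hm y hy.1, by rw [h.map_act m hm, hm0, add_zero]; exact hy.2⟩
  rw [(ρ n).map_csSup' hsne hb]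
  congr 1
  ext z
  constructor
  · rintro ⟨y, hy, rfl⟩
    exact hsub n hn h0 y hy
  · intro hz
    exact ⟨ρ n⁻¹ z, hsub n⁻¹ (N.inv_mem hn) (by rw [h.map_inv hn, h0, neg_zero]) z hz,
      act_act_inv ρ n z⟩

lemma dense_or_exists_generator (h : IsTranslationMap ρ N φ τ) {f : G} (hf : f ∈ N)
    (hτf : τ f = 1) :
    Dense (τ '' N) ∨ ∃ t ∈ N, 0 < τ t ∧ ∀ n ∈ N, ∃ k : ℤ, τ n = k * τ t := by
  let A : AddSubgroup ℝ :=
    { carrier := τ '' N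
      zero_mem' := ⟨1, N.one_mem, by
        have := h.map_zpow hf 0
        rwa [zpow_zero, Int.cast_zero, zero_mul] at this⟩
      add_mem' := by
        rintro _ _ ⟨m, hm, rfl⟩ ⟨n, hn, rfl⟩
        exact ⟨m * n, N.mul_mem hm hn, h.map_mul hm hn⟩
      neg_mem' := by
        rintro _ ⟨n, hn, rfl⟩
        exact ⟨n⁻¹, N.inv_mem hn, h.map_inv hn⟩ }
  have hmem : ∀ r, r ∈ A ↔ ∃ n ∈ N, τ n = r := fun r => Iff.rfl
  obtain hd | ⟨a, ha⟩ := A.dense_or_cyclic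
  · exact Or.inl hd
  · right
    have hdvd : ∀ n ∈ N, ∃ k : ℤ, k • a = τ n := fun n hn =>
      AddSubgroup.mem_closure_singleton.1 (ha ▸ (hmem _).2 ⟨n, hn, rfl⟩)
    obtain ⟨t, ht, hta⟩ := (hmem a).1 (ha ▸ AddSubgroup.mem_closure_singleton_self a)
    have ha0 : a ≠ 0 := by
      rintro rfl
      obtain ⟨k, hk⟩ := hdvd f hf
      rw [smul_zero, hτf] at hk
      exact zero_ne_one hk
    rcases ha0.lt_or_gt with hneg | hpos
    · refine ⟨t⁻¹, N.inv_mem ht, by rw [h.map_inv ht, hta]; linarith, fun n hn => ?_⟩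
      obtain ⟨k, hk⟩ := hdvd n hn
      refine ⟨-k, ?_⟩
      rw [h.map_inv ht, hta, ← hk, zsmul_eq_mul]
      push_cast
      ring
    · refine ⟨t, ht, hta ▸ hpos, fun n hn => ?_⟩
      obtain ⟨k, hk⟩ := hdvd n hn
      exact ⟨k, by rw [hta, ← hk, zsmul_eq_mul]⟩

/-- In the cyclic case, subexponential growth of orbits passes from `H ⧸ N` to `H` at the points
fixed by all elements of `N` with zero translation length. -/
lemma subexpOrbitGrowth_of_cyclic (h : IsTranslationMap ρ N φ τ) [hN : N.Normal] {f : G}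
    (hf : f ∈ N) (hτf : τ f = 1) {t : G} (ht : t ∈ N) (htpos : 0 < τ t)
    (hcyc : ∀ n ∈ N, ∃ k : ℤ, τ n = k * τ t) {H : Subgroup G}
    (hQ : LocallySubexponentialGrowth (↥H ⧸ N.subgroupOf H)) {x : ℝ}
    (hfix : ∀ g, ∀ n ∈ N, τ n = 0 → ρ n (ρ g x) = ρ g x) :
    SubexpOrbitGrowth ρ H x := by
  refine .of_quotient hQ t fun S hS => ?_
  obtain ⟨C, hC⟩ := h.exists_abs_map_act_sub_le_mul hN hf hτf ht htpos hcyc hS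
  refine ⟨⌈2 * C / τ t⌉₊, fun n γ hγ γ' hγ' hmem => ?_⟩
  obtain ⟨k, hk⟩ := hcyc _ hmem
  refine ⟨k, ?_, ?_⟩
  · have h1 := h.map_act _ hmem (ρ γ x)
    rw [← act_mul, inv_mul_cancel_right, hk] at h1
    have h2 := abs_le.1 (hC n γ hγ x)
    have h3 := abs_le.1 (hC n γ' hγ' x)
    have h4 : |(k : ℝ)| * τ t ≤ 2 * C * n := by
      rw [show |(k : ℝ)| * τ t = |k * τ t| by rw [abs_mul, abs_of_pos htpos], abs_le]
      constructor <;> linarith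
    have h5 : |(k : ℝ)| ≤ ⌈2 * C / τ t⌉₊ * n :=
      calc |(k : ℝ)| ≤ 2 * C * n / τ t := (le_div_iff₀ htpos).2 h4
        _ = 2 * C / τ t * n := by ring
        _ ≤ _ := by gcongr; exact Nat.le_ceil _
    exact_mod_cast h5
  · have htk := N.zpow_mem ht (-k)
    have h1 := hfix γ (t ^ (-k) * (γ' * γ⁻¹)) (N.mul_mem htk hmem) (by
      rw [h.map_mul htk hmem, h.map_zpow ht, hk]; push_cast; ring)
    rw [← h1, ← act_mul, ← act_mul]
    congr 2
    group

end IsTranslationMap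

/-- If `N` is normal and its orbits in an invariant closed set grow subexponentially, then either
`N` fixes a point of that set or `N` is semiconjugate to a group of translations. -/
lemma exists_fixed_or_isTranslationMap {N : Subgroup G} (hN : N.Normal) {T : G}
    (hT : ∀ y, y < ρ T y) {F : Set ℝ} (hF : IsClosed F) (hinv : ∀ g, ∀ y ∈ F, ρ g y ∈ F)
    {x : ℝ} (hx : x ∈ F) (hgrowth : SubexpOrbitGrowth ρ N x) :
    (∃ y ∈ F, ∀ n ∈ N, ρ n y = y) ∨
      ∃ φ τ, IsTranslationMap ρ N φ τ ∧ ∃ f ∈ N, τ f = 1 := by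
  by_cases hfix : ∃ y ∈ F, ∀ n ∈ N, ρ n y = y
  · exact Or.inl hfix
  push Not at hfix
  obtain ⟨f, hf, hTf⟩ := exists_act_ge hF (fun n _ => hinv n) hfix hx (ρ T x)
  obtain ⟨hup, hdown⟩ := exists_zpow_act_unbounded hN hgrowth hT hf hTf
  obtain ⟨φ, τ, h1, h2, h3⟩ :=
    exists_semiconj_translation_of_unbounded hgrowth hf ((hT x).trans_le hTf) hup hdown
  exact Or.inr ⟨φ, τ, ⟨h1, h2⟩, f, hf, h3⟩

lemma isClosed_setOf_forall_act_eq (P : G → Prop) : IsClosed {y | ∀ n, P n → ρ n y = y} := by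
  simp only [Set.ofPred_forall]
  exact isClosed_iInter fun n => isClosed_iInter fun _ =>
    isClosed_eq (ρ n).continuous continuous_id

lemma act_mem_setOf_forall_act_eq {P : G → Prop} {g : G} (hP : ∀ n, P n → P (g⁻¹ * n * g))
    {y : ℝ} (hy : ∀ n, P n → ρ n y = y) {n : G} (hn : P n) : ρ n (ρ g y) = ρ g y := by
  conv_rhs => rw [← hy _ (hP n hn), ← act_mul]
  rw [← act_mul]
  congr 2
  group

lemma exists_quasiInvariant_measure_of_chain {Gs : ℕ → Subgroup G} (hN : ∀ i, (Gs i).Normal)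
    (htop : Gs 0 = ⊤) {T : G} (hT : ∀ y, y < ρ T y) (j : ℕ)
    (hquot : ∀ i < j, LocallySubexponentialGrowth (↥(Gs i) ⧸ (Gs (i + 1)).subgroupOf (Gs i)))
    {F : Set ℝ} (hF : IsClosed F) (hinv : ∀ g, ∀ y ∈ F, ρ g y ∈ F) (hne : F.Nonempty)
    (hgrowth : ∀ y ∈ F, SubexpOrbitGrowth ρ (Gs j) y) :
    ∃ μ : Measure ℝ, μ ≠ 0 ∧ IsRadon μ ∧ ∀ g : G, ∃ lam : ℝ, 0 < lam ∧
      Measure.map (⇑(ρ g)) μ = ENNReal.ofReal lam • μ := by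
  induction j generalizing F with
  | zero =>
    obtain ⟨x, hx⟩ := hne
    obtain ⟨y, _, hy⟩ | ⟨φ, τ, h, f, hf, hτf⟩ :=
      exists_fixed_or_isTranslationMap (hN 0) hT hF hinv hx (hgrowth x hx)
    · exact absurd (hy T (htop ▸ Subgroup.mem_top T)) (hT y).ne'
    · refine exists_quasiInvariant_measure_of_affine h.monotone (a := 0) (b := ρ f 0) ?_
        fun g => ⟨1, one_pos, τ g, fun y => ?_⟩
      · rw [h.map_act f hf, hτf]
        exact lt_add_one _
      · rw [h.map_act g (htop ▸ Subgroup.mem_top g), one_mul]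
  | succ j ih =>
    have hNj := hN (j + 1)
    have hQ := hquot j (Nat.lt_succ_self j)
    have step := @ih fun i hi => hquot i (hi.trans (Nat.lt_succ_self j))
    obtain ⟨x, hx⟩ := hne
    obtain ⟨y, hyF, hy⟩ | ⟨φ, τ, h, f, hf, hτf⟩ :=
      exists_fixed_or_isTranslationMap hNj hT hF hinv hx (hgrowth x hx)
    · have hP : ∀ g n, n ∈ Gs (j + 1) → g⁻¹ * n * g ∈ Gs (j + 1) := fun g n hn => by
        simpa using hNj.conj_mem n hn g⁻¹
      have hinv' : ∀ g z, (∀ n, n ∈ Gs (j + 1) → ρ n z = z) →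
          ∀ n, n ∈ Gs (j + 1) → ρ n (ρ g z) = ρ g z := fun g z hz n hn =>
        act_mem_setOf_forall_act_eq (hP g) hz hn
      refine step (hF.inter (isClosed_setOf_forall_act_eq (ρ := ρ) (· ∈ Gs (j + 1))))
        (fun g z hz => ⟨hinv g z hz.1, hinv' g z hz.2⟩) ⟨y, hyF, hy⟩ fun z hz => ?_
      refine .of_quotient hQ 1 fun S hS => ⟨0, fun n γ hγ γ' hγ' hmem => ⟨0, by simp, ?_⟩⟩
      rw [zpow_zero, act_one]
      have h1 := hinv' γ z hz.2 _ hmem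
      rwa [← act_mul, inv_mul_cancel_right] at h1
    obtain hd | ⟨t, ht, htpos, hcyc⟩ := h.dense_or_exists_generator hf hτf
    · refine exists_quasiInvariant_measure_of_affine h.monotone (a := 0) (b := ρ f 0) ?_
        (h.exists_affine_of_dense hNj hf hτf hd)
      rw [h.map_act f hf, hτf]
      exact lt_add_one _
    · have hP : ∀ g n, (n ∈ Gs (j + 1) ∧ τ n = 0) →
          g⁻¹ * n * g ∈ Gs (j + 1) ∧ τ (g⁻¹ * n * g) = 0 := fun g n hn => by
        have h1 := hNj.conj_mem n hn.1 g⁻¹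
        have h2 := h.map_conj_of_cyclic hNj hf hτf ht htpos hcyc g⁻¹ hn.1
        rw [inv_inv] at h1 h2
        exact ⟨h1, h2.trans hn.2⟩
      have hinv' : ∀ g z, (∀ n, (n ∈ Gs (j + 1) ∧ τ n = 0) → ρ n z = z) →
          ∀ n, (n ∈ Gs (j + 1) ∧ τ n = 0) → ρ n (ρ g z) = ρ g z := fun g z hz n hn =>
        act_mem_setOf_forall_act_eq (hP g) hz hn
      obtain ⟨y, hyF, hy⟩ := h.exists_fixed_mem hf hτf hF (fun n _ => hinv n) hx
      exact step (hF.inter (isClosed_setOf_forall_act_eq (ρ := ρ)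
          fun n => n ∈ Gs (j + 1) ∧ τ n = 0))
        (fun g z hz => ⟨hinv g z hz.1, hinv' g z hz.2⟩) ⟨y, hyF, fun n hn => hy n hn.1 hn.2⟩
        fun z hz => h.subexpOrbitGrowth_of_cyclic hf hτf ht htpos hcyc hQ
          fun g n hn h0 => hinv' g z hz.2 n ⟨hn, h0⟩

lemma subexpOrbitGrowth_bot (x : ℝ) : SubexpOrbitGrowth ρ ⊥ x := by
  intro S _ hone _ hS c hc
  have hS1 : S = 1 := Set.Subset.antisymm
    (fun s hs => Set.mem_one.2 (Subgroup.mem_bot.1 (hS hs))) (Set.one_subset.2 hone)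
  refine Filter.Eventually.of_forall fun n => ?_
  rw [hS1, one_pow, ← Set.singleton_one, Set.image_singleton, Set.ncard_singleton, Nat.cast_one]
  exact one_le_pow₀ hc.le

end Action

/-- If `G` admits a finite normal filtration `{1} = G_{d+1} ⊴ G_d ⊴ ⋯ ⊴ G_0 = G` whose
successive quotients have locally subexponential growth, `G` acts on the line by
order-preserving homeomorphisms, and some `T ∈ G` acts freely, then there is a nonzero
Radon measure on ℝ quasi-invariant under `G`. -/
theorem classS_quasiInvariant_measure {G : Type*} [Group G]
    (d : ℕ) (Gs : ℕ → Subgroup G)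
    (hN : ∀ i, (Gs i).Normal)
    (htop : Gs 0 = ⊤) (hbot : Gs (d + 1) = ⊥)
    (hchain : ∀ i, Gs (i + 1) ≤ Gs i)
    (hquot : ∀ i ≤ d,
      haveI : ((Gs (i + 1)).subgroupOf (Gs i)).Normal := (hN (i + 1)).subgroupOf (Gs i)
      LocallySubexponentialGrowth (↥(Gs i) ⧸ (Gs (i + 1)).subgroupOf (Gs i)))
    (ρ : G →* (ℝ ≃o ℝ)) (T : G) (hT : ∀ x : ℝ, ρ T x ≠ x) :
    ∃ μ : Measure ℝ, μ ≠ 0 ∧ IsRadon μ ∧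
      ∀ g : G, ∃ lam : ℝ, 0 < lam ∧
        Measure.map (⇑(ρ g)) μ = ENNReal.ofReal lam • μ := by
  have key : ∀ {T : G}, (∀ y, y < ρ T y) → _ := fun hT =>
    exists_quasiInvariant_measure_of_chain hN htop hT (d + 1)
      (fun i hi => hquot i (Nat.lt_succ_iff.1 hi)) isClosed_univ (fun _ _ _ => Set.mem_univ _)
      Set.univ_nonempty (fun y _ => hbot ▸ subexpOrbitGrowth_bot y)
  exact (forall_lt_act_or_forall_lt_act_inv hT).elim key key
end

section
/- Let G be a group acting on the real line by order-preserving homeomorphisms such that every finitely generated subgroup of G has subexponential growth. Assume there exists T ∈ G with T(x) ≠ x for all x ∈ ℝ. Then there exists a nonzero Radon measure μ on ℝ that is invariant under G, i.e., g_*μ = μ for all g ∈ G, where g_*μ(B) = μ(g⁻¹(B)). -/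
open MeasureTheory Pointwise

open Set Filter Topology

theorem map_inv_apply_eq_self {G X : Type*} [Group G] [LE X] (ρ : G →* (X ≃o X)) {f : G} {u : X}
    (hu : ρ f u = u) : ρ f⁻¹ u = u := by
  conv_lhs => rw [← hu]
  simp

theorem Set.Finite.pow_of_monoid {M : Type*} [Monoid M] {s : Set M} (hs : s.Finite) (n : ℕ) :
    (s ^ n).Finite := by
  induction n with
  | zero => simp [← Set.singleton_one]
  | succ n ih => rw [pow_succ]; exact ih.mul hs

theorem LocallySubexponentialGrowth.not_pingPong {G X : Type*} [Group G] [LinearOrder X]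
    (hG : LocallySubexponentialGrowth G) (ρ : G →* (X ≃o X)) {f g : G} {a b : X} (hab : a ≤ b)
    (ha : a ≤ ρ f a) (hfg : ρ f b < ρ g a) (hb : ρ g b ≤ b) : False := by
  set S₀ : Set G := {1, f, g, f⁻¹, g⁻¹} with hS₀
  have hfin : S₀.Finite := by simp [hS₀]
  set K := Subgroup.closure S₀
  set S : Set K := Subtype.val ⁻¹' S₀ with hS
  have hFG : K.FG := ⟨hfin.toFinset, by simp [K]⟩
  have hSfin : S.Finite := hfin.preimage Subtype.val_injective.injOn
  obtain ⟨n, hn, hn1⟩ := ((hG K hFG S hSfin (by simp [hS, hS₀])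
    (fun s hs => by
      simp only [hS, hS₀, mem_preimage, mem_insert_iff, mem_singleton_iff,
        Subgroup.coe_inv] at hs ⊢
      rcases hs with h | h | h | h | h <;> simp [h])
    (Subgroup.closure_closure_coe_preimage) (3 / 2) (by norm_num)).and
      (eventually_ge_atTop 1)).exists
  let f' : K := ⟨f, Subgroup.subset_closure (by simp [hS₀])⟩
  let g' : K := ⟨g, Subgroup.subset_closure (by simp [hS₀])⟩
  have hf_le : ρ f a ≤ ρ f b := (ρ f).monotone hab
  have hg_le : ρ g a ≤ ρ g b := (ρ g).monotone hab
  have key : ∀ n : ℕ, (∀ w ∈ ({f', g'} : Set K) ^ n, a ≤ ρ w a ∧ ρ w b ≤ b) ∧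
      (({f', g'} : Set K) ^ n).ncard = 2 ^ n := by
    intro n
    induction n with
    | zero => simp [← Set.singleton_one, mem_singleton_iff]
    | succ n ih =>
      obtain ⟨ih₁, ih₂⟩ := ih
      have hpfin : (({f', g'} : Set K) ^ n).Finite := (toFinite ({f', g'} : Set K)).pow_of_monoid n
      have hpow : ({f', g'} : Set K) ^ (n + 1) =
          (f' * ·) '' (({f', g'} : Set K) ^ n) ∪ (g' * ·) '' (({f', g'} : Set K) ^ n) := by
        rw [pow_succ', Set.insert_eq, Set.union_mul, Set.singleton_mul, Set.singleton_mul]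
      have hab' : ∀ w ∈ ({f', g'} : Set K) ^ n, ρ w a ≤ b := fun w hw =>
        ((ρ w).monotone hab).trans (ih₁ w hw).2
      refine ⟨?_, ?_⟩
      · rw [hpow]
        rintro _ (⟨w, hw, rfl⟩ | ⟨w, hw, rfl⟩) <;> obtain ⟨h₁, h₂⟩ := ih₁ w hw
        · simp only [Subgroup.coe_mul, map_mul, RelIso.mul_apply, f']
          exact ⟨ha.trans ((ρ f).monotone h₁),
            ((ρ f).monotone h₂).trans (hfg.le.trans (hg_le.trans hb))⟩
        · simp only [Subgroup.coe_mul, map_mul, RelIso.mul_apply, g']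
          exact ⟨(ha.trans (hf_le.trans hfg.le)).trans ((ρ g).monotone h₁),
            ((ρ g).monotone h₂).trans hb⟩
      · rw [hpow, Set.ncard_union_eq _ (hpfin.image _) (hpfin.image _),
          Set.ncard_image_of_injective _ (mul_right_injective f'),
          Set.ncard_image_of_injective _ (mul_right_injective g'), ih₂, pow_succ]
        · ring
        · rw [Set.disjoint_left]
          rintro _ ⟨w, hw, rfl⟩ ⟨v, hv, hvw⟩
          have h₁ : ρ g (ρ v a) = ρ f (ρ w a) := by
            have := congrArg (fun k : K => ρ k a) hvw
            simpa [f', g'] using this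
          have h₂ : ρ f (ρ w a) ≤ ρ f b := (ρ f).monotone (hab' w hw)
          have h₃ : ρ g a ≤ ρ g (ρ v a) := (ρ g).monotone (ih₁ v hv).1
          exact absurd (h₂.trans_lt (hfg.trans_le h₃)) (by rw [h₁]; exact lt_irrefl _)
  have hsub : ({f', g'} : Set K) ⊆ S := by
    rintro _ (rfl | rfl) <;> simp [hS, hS₀, f', g']
  have hcard : 2 ^ n ≤ (S ^ n).ncard := by
    rw [← (key n).2]
    exact Set.ncard_le_ncard (Set.pow_subset_pow_left hsub) (hSfin.pow_of_monoid n)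
  rw [Nat.card_coe_set_eq] at hn
  have h₁ : (2 : ℝ) ^ n ≤ (3 / 2) ^ n := le_trans (by exact_mod_cast hcard) hn
  exact absurd h₁ (not_le.2 (pow_lt_pow_left₀ (by norm_num) (by norm_num) (by omega)))

/-- Iterates of a point that moves down decrease past every `ε`, unless they meet a fixed point. -/
theorem OrderIso.exists_pow_lt {X : Type*} [ConditionallyCompleteLinearOrder X] (e : X ≃o X)
    {ε c : X} (hc : e c < c) (h : ∀ z, ε ≤ z → z ≤ c → e z ≠ z) : ∃ k : ℕ, (e ^ k) c < ε := by
  by_contra! hk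
  have hne : (range fun k : ℕ => (e ^ k) c).Nonempty := range_nonempty _
  have hbd : BddBelow (range fun k : ℕ => (e ^ k) c) := ⟨ε, by rintro _ ⟨k, rfl⟩; exact hk k⟩
  set L := sInf (range fun k : ℕ => (e ^ k) c)
  have hL : ∀ k : ℕ, L ≤ (e ^ k) c := fun k => csInf_le hbd ⟨k, rfl⟩
  refine h L (le_csInf hne (by rintro _ ⟨k, rfl⟩; exact hk k)) (by simpa using hL 0)
    (le_antisymm ?_ ?_)
  · refine le_csInf hne ?_
    rintro _ ⟨k, rfl⟩
    calc e L ≤ e ((e ^ k) c) := e.monotone (hL k)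
      _ = (e ^ k) (e c) := by rw [← RelIso.mul_apply, ← RelIso.mul_apply, (Commute.self_pow e k).eq]
      _ ≤ (e ^ k) c := (e ^ k).monotone hc.le
  · rw [← e.symm_apply_le]
    refine le_csInf hne ?_
    rintro _ ⟨k, rfl⟩
    rw [e.symm_apply_le]
    simpa [pow_succ'] using hL (k + 1)

/-- The interval between a fixed point of `f` and a larger `g`-translate of it contains another
fixed point of `f`. -/
theorem LocallySubexponentialGrowth.exists_fixed_mem_Ioc {G X : Type*} [Group G]
    [ConditionallyCompleteLinearOrder X]
    (hG : LocallySubexponentialGrowth G) (ρ : G →* (X ≃o X)) {f g : G} {u : X}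
    (hu : ρ f u = u) (hgu : u < ρ g u) : ∃ z ∈ Ioc u (ρ g u), ρ f z = z := by
  by_contra! h
  wlog hlt : ρ f (ρ g u) < ρ g u generalizing f
  · refine this (f := f⁻¹) ?_ ?_ ?_
    · exact map_inv_apply_eq_self ρ hu
    · intro z hz hfz
      refine h z hz ?_
      simpa using map_inv_apply_eq_self ρ hfz
    · have h₁ := lt_of_le_of_ne (not_lt.1 hlt) (h _ ⟨hgu, le_rfl⟩).symm
      have := (ρ f⁻¹).strictMono h₁
      simpa using this
  set c := ρ g u with hc
  have hpow : ∀ n : ℕ, (ρ f ^ n) u = u := fun n => by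
    induction n with
    | zero => rfl
    | succ n ih => rw [pow_succ, RelIso.mul_apply, hu, ih]
  have hattr : ∀ ε, u < ε → ∃ k : ℕ, (ρ f ^ k) c < ε := fun ε hε =>
    (ρ f).exists_pow_lt hlt fun z hz₁ hz₂ => h z ⟨hε.trans_le hz₁, hz₂⟩
  set b := ρ g⁻¹ (ρ f⁻¹ c) with hb
  have hub : u < b := by
    have h₁ : c < ρ f⁻¹ c := by simpa using (ρ f⁻¹).strictMono hlt
    simpa [hb, hc] using (ρ g⁻¹).strictMono h₁
  have hfgb : ρ f (ρ g b) = c := by simp [hb]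
  obtain ⟨k, hk⟩ := hattr (min b c) (lt_min hub hgu)
  have hB : u < (ρ f ^ (k + 1)) c := by
    conv_lhs => rw [← hpow (k + 1)]
    exact (ρ f ^ (k + 1)).strictMono hgu
  obtain ⟨n, hn⟩ := hattr _ hB
  refine hG.not_pingPong ρ (f := f ^ n) (g := f ^ (k + 1) * g) (a := u) (b := min b c)
    (lt_min hub hgu).le ?_ ?_ ?_
  · rw [map_pow, hpow]
  · rw [map_mul, map_pow, map_pow, RelIso.mul_apply]
    exact ((ρ f ^ n).monotone (min_le_right _ _)).trans_lt hn
  · refine le_trans ((ρ _).monotone (min_le_left b c)) ?_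
    rw [map_mul, map_pow, RelIso.mul_apply, pow_succ, RelIso.mul_apply, hfgb]
    exact hk.le

/-- The order-reversed version of `LocallySubexponentialGrowth.exists_fixed_mem_Ioc`. -/
theorem LocallySubexponentialGrowth.exists_fixed_mem_Ico {G X : Type*} [Group G]
    [ConditionallyCompleteLinearOrder X]
    (hG : LocallySubexponentialGrowth G) (ρ : G →* (X ≃o X)) {f g : G} {u : X}
    (hu : ρ f u = u) (hgu : ρ g u < u) : ∃ z ∈ Ico (ρ g u) u, ρ f z = z := by
  let ρ' : G →* (Xᵒᵈ ≃o Xᵒᵈ) :=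
    { toFun := fun g => (ρ g).dual
      map_one' := by ext; simp
      map_mul' := fun g h => by ext; simp }
  obtain ⟨z, ⟨hz₁, hz₂⟩, hz⟩ := hG.exists_fixed_mem_Ioc ρ' (f := f) (g := g)
    (u := OrderDual.toDual u) (congrArg OrderDual.toDual hu) (OrderDual.toDual_lt_toDual.2 hgu)
  exact ⟨OrderDual.ofDual z, ⟨hz₂, hz₁⟩, hz⟩

theorem OrderIso.exists_isGreatest_fixed_le {X : Type*} [ConditionallyCompleteLinearOrder X]
    (e : X ≃o X) {x z : X} (hz : e z = z) (hzx : z ≤ x) : ∃ u, IsGreatest {y | e y = y ∧ y ≤ x} u := by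
  set A := {y | e y = y ∧ y ≤ x}
  have hne : A.Nonempty := ⟨z, hz, hzx⟩
  have hbd : BddAbove A := ⟨x, fun y hy => hy.2⟩
  have himg : e '' A = A := by
    ext y
    constructor
    · rintro ⟨w, hw, rfl⟩
      rwa [hw.1]
    · exact fun hy => ⟨y, hy, hy.1⟩
  refine ⟨sSup A, ⟨?_, csSup_le hne fun y hy => hy.2⟩, fun y hy => le_csSup hbd hy⟩
  rw [e.map_csSup' hne hbd, himg]

theorem OrderIso.exists_isLeast_le_fixed {X : Type*} [ConditionallyCompleteLinearOrder X]
    (e : X ≃o X) {x z : X} (hz : e z = z) (hzx : x ≤ z) : ∃ u, IsLeast {y | e y = y ∧ x ≤ y} u := by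
  obtain ⟨u, hu⟩ := e.dual.exists_isGreatest_fixed_le (x := OrderDual.toDual x)
    (z := OrderDual.toDual z) (congrArg OrderDual.toDual hz) hzx
  exact ⟨OrderDual.ofDual u, hu.1, fun y hy => hu.2 hy⟩

/-- Every element with a fixed point has one in each interval `[T⁻¹ x, x]`. -/
theorem LocallySubexponentialGrowth.exists_fixed_mem_Icc {G X : Type*} [Group G]
    [ConditionallyCompleteLinearOrder X]
    (hG : LocallySubexponentialGrowth G) (ρ : G →* (X ≃o X)) {T : G} (hT : ∀ x, x < ρ T x)
    {f : G} {z : X} (hz : ρ f z = z) (x : X) : ∃ y ∈ Icc (ρ T⁻¹ x) x, ρ f y = y := by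
  have hT' : ∀ x, ρ T⁻¹ x < x := fun x => by simpa using hT (ρ T⁻¹ x)
  rcases le_total x z with h | h
  · obtain ⟨u, ⟨hu, hxu⟩, hmin⟩ := (ρ f).exists_isLeast_le_fixed hz h
    obtain ⟨y, ⟨hy₁, hy₂⟩, hy⟩ := hG.exists_fixed_mem_Ico ρ hu (hT' u)
    refine ⟨y, ⟨((ρ T⁻¹).monotone hxu).trans hy₁, ?_⟩, hy⟩
    by_contra! hxy
    exact absurd (hmin ⟨hy, hxy.le⟩) (not_le.2 hy₂)
  · obtain ⟨u, ⟨hu, hux⟩, hmax⟩ := (ρ f).exists_isGreatest_fixed_le hz h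
    refine ⟨u, ⟨?_, hux⟩, hu⟩
    obtain ⟨y, ⟨hy₁, hy₂⟩, hy⟩ := hG.exists_fixed_mem_Ioc ρ hu (hT u)
    have hxy : x < y := by
      by_contra! hxy
      exact absurd (hmax ⟨hy, hxy⟩) (not_le.2 hy₁)
    simpa using (ρ T⁻¹).monotone (hxy.le.trans hy₂)

/-- All elements that have a fixed point share a common one. -/
theorem LocallySubexponentialGrowth.exists_common_fixed {G X : Type*} [Group G] [Nonempty X]
    [ConditionallyCompleteLinearOrder X]
    (hG : LocallySubexponentialGrowth G) (ρ : G →* (X ≃o X)) {T : G} (hT : ∀ x, x < ρ T x) :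
    ∃ p, ∀ f : G, ∀ z, ρ f z = z → ρ f p = p := by
  obtain ⟨x⟩ := ‹Nonempty X›
  set A : Set X := {u | ∃ f, IsGreatest {y | ρ f y = y ∧ y ≤ x} u} with hA
  have hbound : ∀ u ∈ A, ρ T⁻¹ x ≤ u := by
    rintro u ⟨f, hu⟩
    obtain ⟨y, hy, hfy⟩ := hG.exists_fixed_mem_Icc ρ hT hu.1.1 x
    exact hy.1.trans (hu.2 ⟨hfy, hy.2⟩)
  have hbd : BddBelow A := ⟨_, hbound⟩
  have hne : A.Nonempty :=
    ⟨x, 1, ⟨by simp, fun y hy => hy.2⟩⟩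
  refine ⟨sInf A, fun f z hz => ?_⟩
  set p := sInf A
  by_contra hp
  obtain ⟨y, hy, hfy⟩ := hG.exists_fixed_mem_Icc ρ hT hz x
  obtain ⟨e, he⟩ := (ρ f).exists_isGreatest_fixed_le hfy hy.2
  have hpe : p ≤ e := csInf_le hbd ⟨f, he⟩
  obtain ⟨v, ⟨hv, hpv⟩, hmin⟩ := (ρ f).exists_isLeast_le_fixed he.1.1 hpe
  have hvx : v ≤ x := (hmin ⟨he.1.1, hpe⟩).trans he.1.2
  have hpv' : p < v := lt_of_le_of_ne hpv fun h => hp (by rw [h, hv])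
  obtain ⟨w, ⟨k, hw⟩, hwv⟩ := (csInf_lt_iff hbd hne).1 hpv'
  have hpw : p ≤ w := csInf_le hbd ⟨k, hw⟩
  have key : ∀ g : G, ρ g v = v → ¬ w < ρ g w := fun g hgv hgw => by
    obtain ⟨y, ⟨hy₁, hy₂⟩, hy⟩ := hG.exists_fixed_mem_Ioc ρ hw.1.1 hgw
    have : ρ g w < v := by
      conv_rhs => rw [← hgv]
      exact (ρ g).strictMono hwv
    exact absurd (hw.2 ⟨hy, hy₂.trans (this.le.trans hvx)⟩) (not_le.2 hy₁)
  have hfw : ρ f w ≠ w := fun h => absurd (hmin ⟨h, hpw⟩) (not_le.2 hwv)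
  rcases lt_or_gt_of_ne hfw with h | h
  · refine key f⁻¹ ?_ ?_
    · exact map_inv_apply_eq_self ρ hv
    · simpa using (ρ f⁻¹).strictMono h
  · exact key f hv h

/-- A sequence within bounded distance of `n * l` has slope `l`. -/
theorem tendsto_div_natCast_of_bounded {a b : ℕ → ℝ} {l C : ℝ}
    (hb : Tendsto (fun n : ℕ => b n / n) atTop (𝓝 l)) (h : ∀ n, |a n - b n| ≤ C) :
    Tendsto (fun n : ℕ => a n / n) atTop (𝓝 l) := by
  have h₀ : Tendsto (fun n : ℕ => (a n - b n) / n) atTop (𝓝 0) := by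
    refine squeeze_zero_norm (fun n => ?_) (tendsto_const_div_atTop_nhds_zero_nat C)
    rw [norm_div, Real.norm_eq_abs, Real.norm_natCast]
    exact div_le_div_of_nonneg_right (h n) n.cast_nonneg
  simpa [← add_div] using h₀.add hb

section BiOrdered

variable {G : Type*} [Group G] [Preorder G] [MulLeftMono G] [MulRightMono G]

theorem pow_mul_le_mul_pow_of_mul_le_mul {g h : G} (hgh : g * h ≤ h * g) (n : ℕ) :
    g ^ n * h ≤ h * g ^ n := by
  induction n with
  | zero => simp
  | succ n ih =>
    calc g ^ (n + 1) * h = g ^ n * (g * h) := by rw [pow_succ, mul_assoc]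
      _ ≤ g ^ n * (h * g) := mul_le_mul_right hgh _
      _ = g ^ n * h * g := by rw [mul_assoc]
      _ ≤ h * g ^ n * g := mul_le_mul_left ih _
      _ = h * g ^ (n + 1) := by rw [pow_succ, mul_assoc]

theorem mul_pow_le_pow_mul_of_mul_le_mul {g h : G} (hgh : g * h ≤ h * g) (n : ℕ) :
    g * h ^ n ≤ h ^ n * g := by
  induction n with
  | zero => simp
  | succ n ih =>
    calc g * h ^ (n + 1) = g * h ^ n * h := by rw [pow_succ, mul_assoc]
      _ ≤ h ^ n * g * h := mul_le_mul_left ih _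
      _ = h ^ n * (g * h) := by rw [mul_assoc]
      _ ≤ h ^ n * (h * g) := mul_le_mul_right hgh _
      _ = h ^ (n + 1) * g := by rw [pow_succ, mul_assoc]

theorem pow_mul_pow_le_mul_pow_of_mul_le_mul {g h : G} (hgh : g * h ≤ h * g) (n : ℕ) :
    g ^ n * h ^ n ≤ (g * h) ^ n := by
  induction n with
  | zero => simp
  | succ n ih =>
    calc g ^ (n + 1) * h ^ (n + 1) = g * (g ^ n * h) * h ^ n := by
          rw [pow_succ', pow_succ' h]; simp only [mul_assoc]
      _ ≤ g * (h * g ^ n) * h ^ n :=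
        mul_le_mul_left (mul_le_mul_right (pow_mul_le_mul_pow_of_mul_le_mul hgh n) _) _
      _ = g * h * (g ^ n * h ^ n) := by simp only [mul_assoc]
      _ ≤ g * h * (g * h) ^ n := mul_le_mul_right ih _
      _ = (g * h) ^ (n + 1) := by rw [pow_succ']

theorem mul_pow_le_pow_mul_pow_of_mul_le_mul {g h : G} (hgh : g * h ≤ h * g) (n : ℕ) :
    (h * g) ^ n ≤ h ^ n * g ^ n := by
  induction n with
  | zero => simp
  | succ n ih =>
    calc (h * g) ^ (n + 1) = h * g * (h * g) ^ n := by rw [pow_succ']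
      _ ≤ h * g * (h ^ n * g ^ n) := mul_le_mul_right ih _
      _ = h * (g * h ^ n) * g ^ n := by simp only [mul_assoc]
      _ ≤ h * (h ^ n * g) * g ^ n :=
        mul_le_mul_left (mul_le_mul_right (mul_pow_le_pow_mul_of_mul_le_mul hgh n) _) _
      _ = h ^ (n + 1) * g ^ (n + 1) := by
          rw [pow_succ', pow_succ' g]; simp only [mul_assoc]

/-- A form of Hölder's theorem: a totally preordered bi-invariant group in which the powers of some
`T` are cofinal has a monotone additive map to `ℝ` that is positive at `T`. -/
theorem exists_monotone_additive_of_archimedean (htot : ∀ g h : G, g ≤ h ∨ h ≤ g) {T : G}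
    (hT : ∀ m n : ℤ, T ^ m ≤ T ^ n → m ≤ n) (hcof : ∀ g : G, ∃ n : ℤ, T ^ n ≤ g ∧ g ≤ T ^ (n + 1)) :
    ∃ φ : G → ℝ, (∀ g h, φ (g * h) = φ g + φ h) ∧ Monotone φ ∧ 0 < φ T := by
  choose N hN₁ hN₂ using hcof
  have hmono : ∀ {g h}, g ≤ h → N g ≤ N h + 1 := fun {g h} hgh =>
    hT _ _ ((hN₁ g).trans (hgh.trans (hN₂ h)))
  have hmul₁ : ∀ g h, N (g * h) ≤ N g + N h + 2 := fun g h => by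
    refine hT _ _ ((hN₁ _).trans ((mul_le_mul' (hN₂ g) (hN₂ h)).trans_eq ?_))
    rw [← zpow_add]; congr 1; ring
  have hmul₂ : ∀ g h, N g + N h ≤ N (g * h) + 1 := fun g h => by
    refine hT _ _ (le_trans ?_ (hN₂ (g * h)))
    rw [zpow_add]
    exact mul_le_mul' (hN₁ g) (hN₁ h)
  have hlow : ∀ (g : G) (n : ℕ), (n : ℤ) * (N g - 1) ≤ N (g ^ n) + 2 := fun g n => by
    induction n with
    | zero =>
      have := hT 0 (N 1 + 1) (by simpa using hN₂ 1)
      simp only [Nat.cast_zero, zero_mul, pow_zero]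
      omega
    | succ n ih =>
      have := hmul₂ (g ^ n) g
      rw [← pow_succ] at this
      push_cast
      linarith
  have hlim : ∀ g : G, ∃ l : ℝ, Tendsto (fun n : ℕ => (N (g ^ n) : ℝ) / n) atTop (𝓝 l) := by
    intro g
    have hsub : Subadditive fun n : ℕ => (N (g ^ n) : ℝ) + 2 := fun m n => by
      have := hmul₁ (g ^ m) (g ^ n)
      rw [← pow_add] at this
      have : (N (g ^ (m + n)) : ℝ) ≤ N (g ^ m) + N (g ^ n) + 2 := by exact_mod_cast this
      linarith
    refine ⟨hsub.lim, tendsto_div_natCast_of_bounded (hsub.tendsto_lim ?_) (C := 2) (by simp)⟩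
    refine ⟨min 0 (N g - 1), ?_⟩
    rintro _ ⟨n, rfl⟩
    rcases Nat.eq_zero_or_pos n with rfl | hn
    · simp
    · refine (min_le_right _ _).trans ?_
      rw [le_div_iff₀ (by exact_mod_cast hn), mul_comm]
      exact_mod_cast hlow g n
  choose φ hφ using hlim
  refine ⟨φ, fun g h => ?_, fun g h hgh => ?_, ?_⟩
  · refine tendsto_nhds_unique (hφ (g * h)) (tendsto_div_natCast_of_bounded
      (b := fun n => N (g ^ n) + N (h ^ n)) (C := 3) ?_ fun n => ?_)
    · simpa only [add_div] using (hφ g).add (hφ h)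
    · have key : N ((g * h) ^ n) ≤ N (g ^ n) + N (h ^ n) + 3 ∧
          N (g ^ n) + N (h ^ n) ≤ N ((g * h) ^ n) + 3 := by
        have h₁ := hmul₁ (g ^ n) (h ^ n)
        have h₂ := hmul₁ (h ^ n) (g ^ n)
        have h₃ := hmul₂ (g ^ n) (h ^ n)
        have h₄ := hmul₂ (h ^ n) (g ^ n)
        rcases htot (g * h) (h * g) with hgh | hgh
        · have h₅ := hmono (pow_mul_pow_le_mul_pow_of_mul_le_mul hgh n)
          have h₆ := hmono ((pow_le_pow_left' hgh n).trans
            (mul_pow_le_pow_mul_pow_of_mul_le_mul hgh n))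
          omega
        · have h₅ := hmono (mul_pow_le_pow_mul_pow_of_mul_le_mul hgh n)
          have h₆ := hmono ((pow_mul_pow_le_mul_pow_of_mul_le_mul hgh n).trans
            (pow_le_pow_left' hgh n))
          omega
      have k₁ : (N ((g * h) ^ n) : ℝ) ≤ N (g ^ n) + N (h ^ n) + 3 := by exact_mod_cast key.1
      have k₂ : (N (g ^ n) + N (h ^ n) : ℝ) ≤ N ((g * h) ^ n) + 3 := by exact_mod_cast key.2
      rw [abs_le]
      constructor <;> linarith
  · have h₁ : Tendsto (fun n : ℕ => ((N (h ^ n) : ℝ) + 1) / n) atTop (𝓝 (φ h)) :=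
      tendsto_div_natCast_of_bounded (hφ h) (C := 1) (by simp)
    refine le_of_tendsto_of_tendsto' (hφ g) h₁ fun n => ?_
    refine div_le_div_of_nonneg_right ?_ n.cast_nonneg
    exact_mod_cast hmono (pow_le_pow_left' hgh n)
  · have h₁ : Tendsto (fun n : ℕ => (n : ℝ) / n) atTop (𝓝 1) := by
      refine tendsto_const_nhds.congr' ?_
      filter_upwards [eventually_gt_atTop 0] with n hn
      rw [div_self (by positivity)]
    have h₂ : φ T = 1 := by
      refine tendsto_nhds_unique (hφ T) (tendsto_div_natCast_of_bounded h₁ (C := 1) fun n => ?_)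
      have k₁ := hT (N (T ^ n)) n (by simpa using hN₁ (T ^ n))
      have k₂ := hT n (N (T ^ n) + 1) (by simpa using hN₂ (T ^ n))
      have k₁' : (N (T ^ n) : ℝ) ≤ n := by exact_mod_cast k₁
      have k₂' : (n : ℝ) ≤ N (T ^ n) + 1 := by exact_mod_cast k₂
      rw [abs_le]
      constructor <;> linarith
    rw [h₂]
    exact one_pos

end BiOrdered

theorem OrderIso.lt_apply_of_forall_ne (e : ℝ ≃o ℝ) (he : ∀ x, e x ≠ x) {p : ℝ} (hp : p < e p)
    (x : ℝ) : x < e x := by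
  by_contra! hx
  obtain ⟨z, hz⟩ := mem_range_of_exists_le_of_exists_ge (c := (0 : ℝ))
    (f := fun y => e y - y) (e.continuous.sub continuous_id)
    ⟨x, sub_nonpos.2 hx⟩ ⟨p, sub_nonneg.2 hp.le⟩
  exact he z (sub_eq_zero.1 hz)

/-- The orbit of a point under an increasing homeomorphism moving all points up is cofinal in both
directions. -/
theorem OrderIso.exists_zpow_le_lt_zpow (e : ℝ ≃o ℝ) (he : ∀ x, x < e x) (p x : ℝ) :
    ∃ n : ℤ, (e ^ n) p ≤ x ∧ x < (e ^ (n + 1)) p := by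
  have hinv : ∀ x, e⁻¹ x < x := fun x => by simpa using he (e⁻¹ x)
  have hmono : StrictMono fun n : ℤ => (e ^ n) p := strictMono_int_of_lt_succ fun n => by
    rw [add_comm, zpow_add, zpow_one]
    exact he _
  have hdown : ∀ a b, ∃ k : ℕ, (e⁻¹ ^ k) a < b := fun a b =>
    e⁻¹.exists_pow_lt (hinv a) fun z _ _ => (hinv z).ne
  obtain ⟨k, hk⟩ := hdown x p
  obtain ⟨l, hl⟩ := hdown p x
  have hk' : x < (e ^ (k : ℤ)) p := by
    have := (e ^ k).strictMono hk
    rwa [← RelIso.mul_apply, inv_pow, mul_inv_cancel] at this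
  have hl' : (e ^ (-(l : ℤ))) p ≤ x := by
    rw [zpow_neg, zpow_natCast, ← inv_pow]
    exact hl.le
  obtain ⟨n, hn, hmax⟩ := Int.exists_greatest_of_bdd (P := fun n => (e ^ n) p ≤ x)
    ⟨k, fun z hz => (hmono.lt_iff_lt.1 (hz.trans_lt hk')).le⟩ ⟨_, hl'⟩
  refine ⟨n, hn, ?_⟩
  by_contra! hcon
  have := hmax _ hcon
  omega

/-- If the elements with a fixed point all fix `p`, then the action on the orbit of `p` is monotone
semiconjugate to an action by translations. -/
theorem exists_monotone_additive_of_common_fixed {G : Type*} [Group G] (ρ : G →* (ℝ ≃o ℝ)) {T : G}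
    (hT : ∀ x, x < ρ T x) {p : ℝ} (hp : ∀ f z, ρ f z = z → ρ f p = p) :
    ∃ φ : G → ℝ, (∀ g h, φ (g * h) = φ g + φ h) ∧ (∀ g h, ρ g p ≤ ρ h p → φ g ≤ φ h) ∧
      0 < φ T := by
  let : Preorder G := Preorder.lift fun g => ρ g p
  have hle : ∀ g h : G, g ≤ h ↔ ρ g p ≤ ρ h p := fun g h => Iff.rfl
  have hup : ∀ q : G, p ≤ ρ q p → ∀ k : G, ρ k p ≤ ρ q (ρ k p) := by
    intro q hq k
    rcases hq.eq_or_lt with h | h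
    · have h₁ : ρ (k⁻¹ * q * k) (ρ k⁻¹ p) = ρ k⁻¹ p := by simp [← h]
      have h₂ := congrArg (ρ k) (hp _ _ h₁)
      simp only [map_mul, RelIso.mul_apply, map_inv, RelIso.apply_inv_self] at h₂
      exact h₂.ge
    · exact ((ρ q).lt_apply_of_forall_ne (fun x hx => h.ne' (hp q x hx)) h _).le
  have : MulLeftMono G := ⟨fun k g h hgh => by
    rw [hle] at hgh ⊢
    simpa using hgh⟩
  have : MulRightMono G := ⟨fun k g h hgh => by
    rw [hle] at hgh
    change ρ (g * k) p ≤ ρ (h * k) p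
    have h₁ := hup (g⁻¹ * h) (by simpa using (ρ g⁻¹).monotone hgh) k
    simpa using (ρ g).monotone h₁⟩
  have hmono : StrictMono fun n : ℤ => ρ (T ^ n) p := strictMono_int_of_lt_succ fun n => by
    rw [add_comm, zpow_add, zpow_one, map_mul]
    exact hT _
  obtain ⟨φ, h₁, h₂, h₃⟩ := exists_monotone_additive_of_archimedean (G := G) (T := T)
    (fun g h => le_total (ρ g p) (ρ h p)) (fun m n h => hmono.le_iff_le.1 h) (fun g => by
      obtain ⟨n, h₁, h₂⟩ := (ρ T).exists_zpow_le_lt_zpow hT p (ρ g p)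
      rw [← map_zpow] at h₁ h₂
      exact ⟨n, h₁, h₂.le⟩)
  exact ⟨φ, h₁, fun g h hgh => h₂ hgh, h₃⟩

/-- A monotone semiconjugacy to an action by translations yields an invariant Radon measure. -/
theorem exists_invariant_measure_of_semiconj {G : Type*} [Group G] (ρ : G →* (ℝ ≃o ℝ)) {T : G}
    {F : ℝ → ℝ} (hF : Monotone F) {φ : G → ℝ} (hφ : ∀ g x, F (ρ g x) = F x + φ g)
    (hT : 0 < φ T) :
    ∃ μ : Measure ℝ, μ ≠ 0 ∧ IsRadon μ ∧ ∀ g : G, Measure.map (⇑(ρ g)) μ = μ := by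
  have hlim : ∀ g x, Function.rightLim F (ρ g x) = Function.rightLim F x + φ g := fun g x => by
    have h₁ : Tendsto (ρ g) (𝓝[>] x) (𝓝[>] (ρ g x)) :=
      tendsto_nhdsWithin_iff.2 ⟨(ρ g).continuous.continuousAt.mono_left nhdsWithin_le_nhds,
        eventually_nhdsWithin_of_forall fun y hy => (ρ g).strictMono hy⟩
    have h₂ := (hF.tendsto_rightLim (ρ g x)).comp h₁
    have h₃ := (hF.tendsto_rightLim x).add_const (φ g)
    refine tendsto_nhds_unique h₂ (h₃.congr fun y => (hφ g y).symm)
  refine ⟨hF.stieltjesFunction.measure, fun h => ?_, fun K hK => hK.measure_lt_top, fun g => ?_⟩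
  · have h₁ := hF.stieltjesFunction.measure_Ioc 0 (ρ T 0)
    rw [h, Measure.coe_zero, Pi.zero_apply, hF.stieltjesFunction_eq, hF.stieltjesFunction_eq,
      hlim, eq_comm, ENNReal.ofReal_eq_zero] at h₁
    linarith
  · refine (Measure.ext_of_Ioc _ _ fun a b _ => ?_).symm
    have hpre : ρ g ⁻¹' Ioc a b = Ioc (ρ g⁻¹ a) (ρ g⁻¹ b) := by
      rw [(ρ g).preimage_Ioc, map_inv]
      rfl
    have ha := hlim g (ρ g⁻¹ a)
    have hb := hlim g (ρ g⁻¹ b)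
    simp only [map_inv, RelIso.apply_inv_self] at ha hb
    rw [Measure.map_apply (ρ g).continuous.measurable measurableSet_Ioc, hpre, map_inv,
      StieltjesFunction.measure_Ioc, StieltjesFunction.measure_Ioc]
    simp only [hF.stieltjesFunction_eq, ha, hb]
    congr 1
    ring

theorem exists_monotone_semiconj {G : Type*} [Group G] (ρ : G →* (ℝ ≃o ℝ)) {T : G}
    (hT : ∀ x, x < ρ T x) {p : ℝ} {φ : G → ℝ} (hφ : ∀ g h, φ (g * h) = φ g + φ h)
    (hmono : ∀ g h, ρ g p ≤ ρ h p → φ g ≤ φ h) :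
    ∃ F : ℝ → ℝ, Monotone F ∧ ∀ g x, F (ρ g x) = F x + φ g := by
  set A : ℝ → Set ℝ := fun x => φ '' {g | ρ g p ≤ x} with hA
  have hpos : ∀ x, ∃ n : ℤ, ρ (T ^ n) p ≤ x ∧ x < ρ (T ^ (n + 1)) p := fun x => by
    simpa only [map_zpow] using (ρ T).exists_zpow_le_lt_zpow hT p x
  have hne : ∀ x, (A x).Nonempty := fun x => by
    obtain ⟨n, hn, -⟩ := hpos x
    exact ⟨_, _, hn, rfl⟩
  have hbd : ∀ x, BddAbove (A x) := fun x => by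
    obtain ⟨n, -, hn⟩ := hpos x
    refine ⟨φ (T ^ (n + 1)), ?_⟩
    rintro _ ⟨g, hg, rfl⟩
    exact hmono _ _ (le_trans hg hn.le)
  have hle : ∀ g x, sSup (A x) + φ g ≤ sSup (A (ρ g x)) := fun g x => by
    rw [← le_sub_iff_add_le]
    refine csSup_le (hne x) ?_
    rintro _ ⟨h, hh, rfl⟩
    rw [le_sub_iff_add_le, add_comm, ← hφ]
    refine le_csSup (hbd _) ⟨g * h, ?_, rfl⟩
    simpa using hh
  refine ⟨fun x => sSup (A x), fun x y hxy => csSup_le_csSup (hbd y) (hne x)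
    (image_mono fun g hg => le_trans hg hxy), fun g x => le_antisymm ?_ (hle g x)⟩
  have h₁ : φ 1 = 0 := by simpa using hφ 1 1
  have h₂ := hφ g g⁻¹
  have h₃ := hle g⁻¹ (ρ g x)
  rw [mul_inv_cancel, h₁] at h₂
  simp only [map_inv, RelIso.inv_apply_self] at h₃
  linarith

/-- If `G` has locally subexponential growth, acts on the line by order-preserving
homeomorphisms, and some `T ∈ G` acts freely, then there is a nonzero Radon measure on
ℝ invariant under `G`. -/
theorem locSubexp_invariant_measure {G : Type*} [Group G]
    (hG : LocallySubexponentialGrowth G)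
    (ρ : G →* (ℝ ≃o ℝ)) (T : G) (hT : ∀ x : ℝ, ρ T x ≠ x) :
    ∃ μ : Measure ℝ, μ ≠ 0 ∧ IsRadon μ ∧
      ∀ g : G, Measure.map (⇑(ρ g)) μ = μ := by
  wlog hpos : 0 < ρ T 0 generalizing T
  · refine this T⁻¹ (fun x hx => hT x ?_) ?_
    · simpa using map_inv_apply_eq_self ρ hx
    · simpa using (ρ T⁻¹).strictMono (lt_of_le_of_ne (not_lt.1 hpos) (hT 0))
  have hT' : ∀ x, x < ρ T x := (ρ T).lt_apply_of_forall_ne hT hpos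
  obtain ⟨p, hp⟩ := hG.exists_common_fixed ρ hT'
  obtain ⟨φ, hφ, hmono, hφT⟩ := exists_monotone_additive_of_common_fixed ρ hT' hp
  obtain ⟨F, hF, hFφ⟩ := exists_monotone_semiconj ρ hT' hφ hmono
  exact exists_invariant_measure_of_semiconj ρ hF hFφ hφT
end
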